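/- Let m ≥ 2, suppose (α, {δ_i}_{i=0}^m) represents a minimal norm pair (a, d) of length m, and let X = X(α, {δ_i}, d, m) be the associated m-exceptional module. Let [X]_{m-1} denote the image of X under the natural surjection J_m → J_{m-1}. Then [X]_{m-1} is the internal direct sum of the R_{m-1}[G]-submodule of J_{m-1} generated by [α]_{m-1}, [δ_1]_{m-1}, …, [δ_{m-2}]_{m-1} and the cyclic R_{m-1}[G]-submodule generated by [δ_{m-1}]_{m-1}. -/

import Mathlib

/-!
Common setup.  Throughout, `K/F` is a cyclic Galois extension of degree `p^n`
with Galois group `G = Gal(K/F)` generated by `σ`.  For `0 ≤ i ≤ n`, `K_i`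
denotes the intermediate field of degree `p^i` over `F`, realized here via its
unit group `KiU p σ i` (the units of `K` fixed by `σ^{p^i}`), and
`G_i = Gal(K_i/F)`.  For `m ≥ 1`, `R_m = ℤ/p^m` and `J_m = K^×/K^{×p^m}`.
-/

namespace MSS

variable {F K : Type*} [Field F] [Field K] [Algebra F K]

/-- Action of a field automorphism on the unit group. -/
def umap (σ : K ≃ₐ[F] K) : Kˣ →* Kˣ := Units.map (σ : K →* K)

/-- The norm from `K_j` to `F`, computed in `K` as the product of conjugates
`∏_{k < p^j} σ^k(γ)` (valid for `γ ∈ K_j`). -/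
noncomputable def normHom (p : ℕ) (σ : K ≃ₐ[F] K) (j : ℕ) : Kˣ →* Kˣ :=
  ∏ k ∈ Finset.range (p ^ j), umap (σ ^ k)

/-- The unit group of the intermediate field `K_i`: the units fixed by `σ^{p^i}`. -/
def KiU (p : ℕ) (σ : K ≃ₐ[F] K) (i : ℕ) : Subgroup Kˣ :=
  (umap (σ ^ p ^ i) / MonoidHom.id Kˣ).ker

/-- Membership in `K_a^×` for a level `a ∈ {-∞, 0, 1, …}`; level `-∞` means
the trivial group `{1}`. -/
def levelMem (p : ℕ) (σ : K ≃ₐ[F] K) (a : WithBot ℕ) (γ : Kˣ) : Prop :=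
  WithBot.recBotCoe (γ = 1) (fun i => γ ∈ KiU p σ i) a

/-- `(α, δ)` represents the pair `(a, d)`:  `σ(α)·α^{-d} = ∏_{i=0}^m δ_i^{p^i}` with
`δ_i ∈ K_{a_i}^×` for `i < m`, and
`ξ_p = N_{K/F}(α)^{(d-1)/p} · N_{K_{n-1}/F}(δ_0) · ∏_{i=1}^m N_{K/F}(δ_i)^{p^{i-1}}`. -/
noncomputable def Represents (p n : ℕ) (σ : K ≃ₐ[F] K) (ξ : Kˣ) {m : ℕ}
    (a : Fin m → WithBot ℕ) (d : ℤ) (α : Kˣ) (δ : ℕ → Kˣ) : Prop :=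
  (∀ i : Fin m, levelMem p σ (a i) (δ i)) ∧
  umap σ α = α ^ d * ∏ i ∈ Finset.range (m + 1), δ i ^ p ^ i ∧
  ξ = normHom p σ n α ^ ((d - 1) / (p : ℤ)) * normHom p σ (n - 1) (δ 0) *
      ∏ i ∈ Finset.Icc 1 m, normHom p σ n (δ i) ^ p ^ (i - 1)

/-- `(a, d)` is a norm pair of length `m`: `a ∈ {-∞,0,…,n}^m` with `a_0 < n`,
`d ∈ U_1`, and some `(α, δ)` represents `(a, d)`. -/
noncomputable def IsNormPair (p n : ℕ) (σ : K ≃ₐ[F] K) (ξ : Kˣ) {m : ℕ}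
    (a : Fin m → WithBot ℕ) (d : ℤ) : Prop :=
  (∀ i, a i ≤ (n : WithBot ℕ)) ∧
  (∀ h0 : 0 < m, a ⟨0, h0⟩ < (n : WithBot ℕ)) ∧
  (p : ℤ) ∣ d - 1 ∧
  ∃ (α : Kˣ) (δ : ℕ → Kˣ), Represents p n σ ξ a d α δ

/-- Strict lexicographic order on norm vectors (with `-∞` smallest). -/
def vecLT {m : ℕ} (a a' : Fin m → WithBot ℕ) : Prop :=
  ∃ k : Fin m, (∀ j : Fin m, j < k → a j = a' j) ∧ a k < a' k

/-- The order `d ≤_m d'` on twists: `d' ∈ U_i → d ∈ U_i` for `1 ≤ i ≤ m`, except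
when `p = 2` and `d, d' ∉ U_2`, in which case `d' ∈ -U_i → d ∈ -U_i` for `2 ≤ i ≤ m`. -/
def twistLE (p m : ℕ) (d d' : ℤ) : Prop :=
  ((p = 2 ∧ ¬ (4 : ℤ) ∣ (d - 1) ∧ ¬ (4 : ℤ) ∣ (d' - 1)) →
    ∀ i : ℕ, 2 ≤ i → i ≤ m → ((2 : ℤ) ^ i ∣ (d' + 1)) → ((2 : ℤ) ^ i ∣ (d + 1))) ∧
  (¬ (p = 2 ∧ ¬ (4 : ℤ) ∣ (d - 1) ∧ ¬ (4 : ℤ) ∣ (d' - 1)) →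
    ∀ i : ℕ, 1 ≤ i → i ≤ m → ((p : ℤ) ^ i ∣ (d' - 1)) → ((p : ℤ) ^ i ∣ (d - 1)))

/-- The order `⪯_m` on norm pairs of length `m`. -/
def pairLE (p : ℕ) {m : ℕ} (a : Fin m → WithBot ℕ) (d : ℤ)
    (a' : Fin m → WithBot ℕ) (d' : ℤ) : Prop :=
  vecLT a a' ∨ (a = a' ∧ twistLE p m d d')

/-- `(a, d)` is a minimal norm pair of length `m`. -/
noncomputable def IsMinimalNormPair (p n : ℕ) (σ : K ≃ₐ[F] K) (ξ : Kˣ) {m : ℕ}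
    (a : Fin m → WithBot ℕ) (d : ℤ) : Prop :=
  IsNormPair p n σ ξ a d ∧
  ∀ (a' : Fin m → WithBot ℕ) (d' : ℤ), IsNormPair p n σ ξ a' d' → pairLE p a d a' d'

/-- `α` is an `m`-exceptional element. -/
noncomputable def IsExceptional (p n : ℕ) (σ : K ≃ₐ[F] K) (ξ : Kˣ) (m : ℕ) (α : Kˣ) : Prop :=
  ∃ (a : Fin m → WithBot ℕ) (d : ℤ) (δ : ℕ → Kˣ),
    IsMinimalNormPair p n σ ξ a d ∧ Represents p n σ ξ a d α δ

/-- The subgroup of `q`-th powers in `K^×`. -/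
def powSub (K : Type*) [Field K] (q : ℕ) : Subgroup Kˣ := (powMonoidHom q : Kˣ →* Kˣ).range

/-- The class of a unit in `J_q := K^×/K^{×q}`. -/
def jcls (q : ℕ) (γ : Kˣ) : Kˣ ⧸ powSub K q := QuotientGroup.mk γ

/-- The action of a field automorphism on `J_q = K^×/K^{×q}`. -/
noncomputable def jmap (q : ℕ) (τ : K ≃ₐ[F] K) : (Kˣ ⧸ powSub K q) →* Kˣ ⧸ powSub K q :=
  QuotientGroup.map _ _ (umap τ) (by
    rintro x ⟨y, rfl⟩
    exact ⟨umap τ y, by simp [powMonoidHom, map_pow]⟩)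

/-- The natural map `J_q → J_{q'}` when `q' ∣ q`. -/
noncomputable def resMap (q q' : ℕ) (h : q' ∣ q) : (Kˣ ⧸ powSub K q) →* Kˣ ⧸ powSub K q' :=
  QuotientGroup.map _ _ (MonoidHom.id Kˣ) (by
    rintro x ⟨y, rfl⟩
    obtain ⟨c, rfl⟩ := h
    exact ⟨y ^ c, by simp [powMonoidHom, ← pow_mul, mul_comm]⟩)

/-- The `R_m[G]`-submodule of `J_q` generated by the classes of the elements of `S`:
the subgroup generated by all `σ^k`-conjugates of classes of elements of `S`. -/
noncomputable def galSpan (q : ℕ) (σ : K ≃ₐ[F] K) (S : Set Kˣ) : Subgroup (Kˣ ⧸ powSub K q) :=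
  Subgroup.closure {x | ∃ γ ∈ S, ∃ k : ℕ, x = jcls q (umap (σ ^ k) γ)}

/-- The subgroup `(σ-1)J_q` of `J_q`. -/
noncomputable def augSub (q : ℕ) (σ : K ≃ₐ[F] K) : Subgroup (Kˣ ⧸ powSub K q) :=
  Subgroup.closure {x | ∃ y : Kˣ ⧸ powSub K q, x = jmap q σ y * y⁻¹}

/-- The cyclic `F_p[G]`-submodule of `J_1 = K^×/K^{×p}` generated by `[γ]_1` is a
free `F_p[G_i]`-module (on the generator `[γ]_1`): `[γ]_1` is fixed by `σ^{p^i}`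
and the conjugates `σ^k [γ]_1`, `k < p^i`, are `F_p`-linearly independent. -/
noncomputable def FreeCyc (p : ℕ) (σ : K ≃ₐ[F] K) (i : ℕ) (γ : Kˣ) : Prop :=
  jcls p (umap (σ ^ p ^ i) γ) = jcls p γ ∧
  ∀ c : Fin (p ^ i) → ZMod p,
    (∏ k : Fin (p ^ i), jcls p (umap (σ ^ (k : ℕ)) γ) ^ (c k).val) = 1 → c = 0

/-- An (indexed) internal direct sum decomposition of a commutative group. -/
def IsDirectSumDecomp {G : Type*} [CommGroup G] {ι : Sort*} (f : ι → Subgroup G) : Prop :=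
  iSupIndep f ∧ (⨆ i, f i) = ⊤

/-- The subgroup `F^×` of `K^×` (units coming from the base field). -/
def Funits (F : Type*) {K : Type*} [Field F] [Field K] [Algebra F K] : Subgroup Kˣ :=
  (Units.map (algebraMap F K : F →* K)).range

/-- The subgroup `F^{×p}` of `K^×`. -/
def FpPow (F : Type*) {K : Type*} [Field F] [Field K] [Algebra F K] (p : ℕ) : Subgroup Kˣ :=
  (Funits F).map (powMonoidHom p)

/-- The subgroup `N_{K_i/F}(K_i^×)` of `K^×`. -/
noncomputable def NormSub (p : ℕ) (σ : K ≃ₐ[F] K) (i : ℕ) : Subgroup Kˣ :=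
  (KiU p σ i).map (normHom p σ i)

/-- The subgroup `N_{K_i/F}(K_i^×)·F^{×p}` of `K^×`. -/
noncomputable def NiF (p : ℕ) (σ : K ≃ₐ[F] K) (i : ℕ) : Subgroup Kˣ :=
  NormSub p σ i ⊔ FpPow F p

/-- The `F_p`-dimension of an (elementary abelian `p`-) commutative group `Q`,
computed as the rank of `F_p ⊗_ℤ Q`. -/
noncomputable def fpdim (p : ℕ) (Q : Type*) [CommGroup Q] : Cardinal :=
  Module.rank (ZMod p) (TensorProduct ℤ (ZMod p) (Additive Q))

/-- The invariant `e_i(K/F)`: for `i < n` the `F_p`-dimension of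
`N_{K_i/F}(K_i^×)F^{×p} / N_{K_{i+1}/F}(K_{i+1}^×)F^{×p}`, and for `i = n` the
`F_p`-dimension of `N_{K/F}(K^×)F^{×p}/F^{×p}`. -/
noncomputable def eKF (p n : ℕ) (σ : K ≃ₐ[F] K) (i : ℕ) : Cardinal :=
  if i < n then
    fpdim p ((NiF p σ i) ⧸ (NiF p σ (i + 1)).subgroupOf (NiF p σ i))
  else
    fpdim p ((NiF p σ n) ⧸ (FpPow F p).subgroupOf (NiF p σ n))

/-- The group ring `R_m[G_i] = (ℤ/p^m)[ℤ/p^i]` (for the cyclic group `G_i` of order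
`p^i`). -/
abbrev CycGR (p m i : ℕ) : Type :=
  MonoidAlgebra (ZMod (p ^ m)) (Multiplicative (ZMod (p ^ i)))

/-- The image of the generator `σ` of `G_i` in the group ring `R_m[G_i]`. -/
noncomputable def gen (p m i : ℕ) : CycGR p m i :=
  MonoidAlgebra.of _ _ (Multiplicative.ofAdd (1 : ZMod (p ^ i)))

/-- Standard basis vector of the free `R_m[G]`-module on generators `e_0, …, e_m`. -/
noncomputable def sing (p n m : ℕ) (j : Fin (m + 1)) (c : CycGR p m n) :
    Fin (m + 1) → CycGR p m n :=
  Pi.single j c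

/-- The relations defining the module `X_{a,d,m}`: on generators `y = e_0` and
`x_i = e_{i+1}` (`0 ≤ i < m`), we impose `(σ - d)·y = Σ_i p^i x_i`, and
`(σ^{p^{a_i}} - 1)·x_i = 0` when `a_i ≠ -∞`, resp. `x_i = 0` when `a_i = -∞`. -/
noncomputable def XRels (p n m : ℕ) (a : Fin m → WithBot ℕ) (d : ℤ) :
    Set (Fin (m + 1) → CycGR p m n) :=
  insert
    (sing p n m 0 (gen p m n - (d : ZMod (p ^ m)) • 1) -
      ∑ i : Fin m, sing p n m i.succ ((p : CycGR p m n) ^ (i : ℕ)))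
    {r | ∃ i : Fin m, r = sing p n m i.succ
      (WithBot.recBotCoe (1 : CycGR p m n) (fun k => gen p m n ^ p ^ k - 1) (a i))}

/-- The `R_m[G]`-module `X_{a,d,m}`. -/
noncomputable abbrev Xadm (p n m : ℕ) (a : Fin m → WithBot ℕ) (d : ℤ) :=
  (Fin (m + 1) → CycGR p m n) ⧸ Submodule.span (CycGR p m n) (XRels p n m a d)

/-- Indecomposability of a module. -/
def IsIndecomposable (R M : Type*) [Ring R] [AddCommGroup M] [Module R M] : Prop :=
  (⊤ : Submodule R M) ≠ ⊥ ∧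
  ∀ S T : Submodule R M, S ⊓ T = ⊥ → S ⊔ T = ⊤ → S = ⊥ ∨ T = ⊥

end MSS

namespace MSS

variable {F K : Type*} [Field F] [Field K] [Algebra F K]

/-- The set `X_m = {α, δ_1, …, δ_{m-1}} \ {1}`. -/
def XmSet (m : ℕ) (α : Kˣ) (δ : ℕ → Kˣ) : Set Kˣ :=
  ({α} ∪ δ '' Set.Icc 1 (m - 1)) \ {1}

end MSS

universe u v

namespace MSS

open Polynomial Finset

/-- The relative norm `∑_{t < p^c} σ^{p^a t}` as a polynomial in `σ`. -/
noncomputable def relNorm (p a c : ℕ) : ℤ[X] := ∑ t ∈ range (p ^ c), (X ^ p ^ a) ^ t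

section Poly

variable {p : ℕ}

theorem relNorm_mul_sub (a c : ℕ) :
    relNorm p a c * (X ^ p ^ a - 1) = X ^ p ^ (a + c) - 1 := by
  rw [relNorm, geom_sum_mul, ← pow_mul, ← pow_add]

theorem X_pow_sub_one_dvd (a c : ℕ) : (X ^ p ^ a - 1 : ℤ[X]) ∣ X ^ p ^ (a + c) - 1 :=
  ⟨relNorm p a c, by rw [← relNorm_mul_sub, mul_comm]⟩

theorem X_pow_sub_one_ne_zero (hp : p.Prime) (a : ℕ) : (X ^ p ^ a - 1 : ℤ[X]) ≠ 0 := by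
  simpa using X_pow_sub_C_ne_zero (R := ℤ) (pow_pos hp.pos a) 1

theorem relNorm_mul_relNorm (hp : p.Prime) (a b c : ℕ) :
    relNorm p a b * relNorm p (a + b) c = relNorm p a (b + c) := by
  apply mul_right_cancel₀ (X_pow_sub_one_ne_zero hp a)
  rw [mul_right_comm, relNorm_mul_sub, relNorm_mul_sub, mul_comm, relNorm_mul_sub, add_assoc]

theorem relNorm_zero_right (a : ℕ) : relNorm p a 0 = 1 := by simp [relNorm]

theorem dvd_relNorm_sub (a c : ℕ) :
    (X ^ p ^ a - 1 : ℤ[X]) ∣ relNorm p a c - (p : ℤ[X]) ^ c := by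
  have : relNorm p a c - (p : ℤ[X]) ^ c = ∑ t ∈ range (p ^ c), ((X ^ p ^ a) ^ t - 1) := by
    simp [relNorm]
  rw [this]
  exact dvd_sum fun t _ => by simpa using sub_dvd_pow_sub_pow (X ^ p ^ a : ℤ[X]) 1 t

theorem eval_relNorm (a c : ℕ) (d : ℤ) :
    (relNorm p a c).eval d = ∑ t ∈ range (p ^ c), (d ^ p ^ a) ^ t := by
  simp [relNorm, eval_finsetSum]

theorem eval_relNorm_one (a c : ℕ) : (relNorm p a c).eval 1 = (p : ℤ) ^ c := by
  simp [eval_relNorm]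

theorem exists_eq_eval_add (P : ℤ[X]) (d : ℤ) :
    ∃ Y : ℤ[X], P = ((P.eval d : ℤ) : ℤ[X]) + (X - (d : ℤ[X])) * Y := by
  obtain ⟨Y, hY⟩ := X_sub_C_dvd_sub_C_eval (a := d) (p := P)
  refine ⟨Y, ?_⟩
  simp only [eq_intCast] at hY
  rw [← hY]; ring

theorem exists_eq_eval_one_add (P : ℤ[X]) :
    ∃ Y : ℤ[X], P = ((P.eval 1 : ℤ) : ℤ[X]) + (X - 1) * Y := by
  simpa using exists_eq_eval_add P 1

/-- In the group ring, the norm element controls multiples of `σ - 1` modulo `p`. -/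
theorem X_sub_one_mul_mem (hp : p.Prime) (a : ℕ) {g u v : ℤ[X]}
    (h : (X - 1) * g = (p : ℤ[X]) * u + (X ^ p ^ a - 1) * v) :
    ∃ (c : ℤ) (u' v' : ℤ[X]),
      g = (c : ℤ[X]) * relNorm p 0 a + (p : ℤ[X]) * u' + (X ^ p ^ a - 1) * v' := by
  have h1 := relNorm_mul_sub (p := p) 0 a
  simp only [pow_zero, pow_one, zero_add] at h1
  have hu : (X - 1 : ℤ[X]) ∣ u := by
    have h2 : (p : ℤ) * u.eval 1 = 0 := by
      have := congrArg (eval 1) h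
      simpa using this.symm
    have h3 : u.eval 1 = 0 := by
      rcases mul_eq_zero.1 h2 with h | h
      · exact absurd (by exact_mod_cast h) hp.ne_zero
      · exact h
    obtain ⟨Y, hY⟩ := exists_eq_eval_one_add u
    exact ⟨Y, by rw [hY]; simp [h3]⟩
  obtain ⟨u', rfl⟩ := hu
  obtain ⟨v', hv'⟩ := exists_eq_eval_one_add v
  have hX : (X - 1 : ℤ[X]) ≠ 0 := by simpa using X_sub_C_ne_zero (1 : ℤ)
  refine ⟨v.eval 1, u', v', mul_left_cancel₀ hX ?_⟩
  rw [h]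
  nth_rw 1 [hv']
  rw [← h1]
  ring

theorem X_sub_one_pow_mem (hp : p.Prime) (a : ℕ) :
    ∃ u : ℤ[X], (X - 1 : ℤ[X]) ^ p ^ a = (p : ℤ[X]) * u + (X ^ p ^ a - 1) := by
  have := Fact.mk hp
  have h : ((X - 1 : ℤ[X]) ^ p ^ a - (X ^ p ^ a - 1)).map (Int.castRingHom (ZMod p)) = 0 := by
    simp [sub_pow_char_pow]
  have h2 : C (p : ℤ) ∣ ((X - 1 : ℤ[X]) ^ p ^ a - (X ^ p ^ a - 1)) := by
    rw [C_dvd_iff_dvd_coeff]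
    intro i
    have := congrArg (fun q => coeff q i) h
    simp only [coeff_map, coeff_zero] at this
    exact (ZMod.intCast_zmod_eq_zero_iff_dvd _ p).1 this
  obtain ⟨u, hu⟩ := h2
  refine ⟨u, ?_⟩
  simp only [map_natCast] at hu
  linear_combination hu

theorem dvd_of_dvd_natCast_mul (hp : p.Prime) (a : ℕ) {Q : ℤ[X]}
    (h : (X ^ p ^ a - 1 : ℤ[X]) ∣ (p : ℤ[X]) * Q) : (X ^ p ^ a - 1 : ℤ[X]) ∣ Q := by
  have hm : (X ^ p ^ a - 1 : ℤ[X]).Monic := by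
    simpa using monic_X_pow_sub_C (1 : ℤ) (pow_pos hp.pos a).ne'
  rw [← modByMonic_eq_zero_iff_dvd hm] at h ⊢
  have h1 : (p : ℤ[X]) * Q = (p : ℤ) • Q := by
    simp
  rw [h1, smul_modByMonic] at h
  have : (p : ℤ) ≠ 0 := by exact_mod_cast hp.ne_zero
  exact (smul_eq_zero.1 h).resolve_left this

end Poly

section Number

variable {p : ℕ}

theorem exists_sum_pow_eq_mul_one (hp : p.Prime) {D : ℤ} (hD : (p : ℤ) ∣ D - 1)
    (h2 : p = 2 → (4 : ℤ) ∣ D - 1) :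
    ∃ u : ℤ, ∑ t ∈ range p, D ^ t = p * u ∧ ¬ (p : ℤ) ∣ u := by
  have hp0 : (p : ℤ) ≠ 0 := by exact_mod_cast hp.ne_zero
  have hp1 : ¬ (p : ℤ) ∣ 1 := by
    intro h; exact hp.one_lt.ne' (by simpa using Int.eq_one_of_dvd_one (by positivity) h)
  rcases hp.eq_two_or_odd' with rfl | hodd
  · obtain ⟨k, hk⟩ := h2 rfl
    refine ⟨1 + 2 * k, ?_, by omega⟩
    simp [sum_range_succ]; linarith
  · obtain ⟨k, hk⟩ := hD
    have h := odd_sq_dvd_geom_sum₂_sub (a := (1 : ℤ)) (b := k) (p := p) hodd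
    simp only [one_pow, mul_one] at h
    obtain ⟨l, hl⟩ := h
    have hD' : D = 1 + p * k := by linarith
    refine ⟨1 + p * l, ?_, ?_⟩
    · rw [hD']; linear_combination hl
    · intro h
      exact hp1 ((Int.dvd_add_left (dvd_mul_right _ l)).1 h)

theorem exists_geom_sum_eq_mul (hp : p.Prime) {d : ℤ} (hd : (p : ℤ) ∣ d - 1) (a : ℕ)
    (h2 : p = 2 → (4 : ℤ) ∣ d - 1 ∨ 1 ≤ a) (c : ℕ) :
    ∃ u : ℤ, (relNorm p a c).eval d = (p : ℤ) ^ c * u ∧ ¬ (p : ℤ) ∣ u := by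
  have hp1 : ¬ (p : ℤ) ∣ 1 := by
    intro h; exact hp.one_lt.ne' (by simpa using Int.eq_one_of_dvd_one (by positivity) h)
  induction c with
  | zero => exact ⟨1, by simp [relNorm], hp1⟩
  | succ c ih =>
    obtain ⟨u, hu, hpu⟩ := ih
    have hpow : ∀ k : ℕ, d - 1 ∣ d ^ k - 1 := fun k => by
      simpa using sub_dvd_pow_sub_pow d 1 k
    obtain ⟨w, hw, hpw⟩ := exists_sum_pow_eq_mul_one hp (D := d ^ p ^ (a + c))
      (hd.trans (hpow _)) (by
        rintro rfl
        rcases h2 rfl with h | h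
        · exact h.trans (hpow _)
        · obtain ⟨b, hb⟩ : ∃ b, a + c = b + 1 := ⟨a + c - 1, by omega⟩
          rw [hb, pow_succ, mul_comm, pow_mul]
          have : (4 : ℤ) ∣ d ^ 2 - 1 := by
            obtain ⟨k, hk⟩ := hd
            refine ⟨k ^ 2 + k, ?_⟩
            have : d = 2 * k + 1 := by push_cast at hk; linarith
            rw [this]; ring
          exact this.trans (by simpa using sub_dvd_pow_sub_pow (d ^ 2) 1 (2 ^ b)))
    refine ⟨u * w, ?_, ?_⟩
    · have h1 : (relNorm p (a + c) 1).eval d = p * w := by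
        rw [eval_relNorm, pow_one, hw]
      rw [← relNorm_mul_relNorm hp, eval_mul, hu, h1]; ring
    · intro h
      rcases (Nat.prime_iff_prime_int.1 hp).dvd_or_dvd h with h | h
      · exact hpu h
      · exact hpw h

end Number

end MSS

namespace MSS

open Polynomial Finset

section Lev

variable {A : Type*} [AddCommGroup A] [Module ℤ[X] A] {p n : ℕ}

variable (A) in
/-- The elements fixed by `σ^{p^a}`. -/
noncomputable def lev (p a : ℕ) : Submodule ℤ[X] A :=
  Submodule.torsionBy ℤ[X] A (X ^ p ^ a - 1)

theorem mem_lev {a : ℕ} {x : A} : x ∈ lev A p a ↔ (X ^ p ^ a - 1 : ℤ[X]) • x = 0 :=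
  Submodule.mem_torsionBy_iff _ _

theorem smul_eq_zero_of_dvd {a : ℕ} {x : A} (hx : x ∈ lev A p a) {g : ℤ[X]}
    (h : (X ^ p ^ a - 1 : ℤ[X]) ∣ g) : g • x = 0 := by
  obtain ⟨r, rfl⟩ := h
  rw [mul_comm, mul_smul, mem_lev.1 hx, smul_zero]

theorem smul_eq_of_dvd_sub {a : ℕ} {x : A} (hx : x ∈ lev A p a) {g h : ℤ[X]}
    (hd : (X ^ p ^ a - 1 : ℤ[X]) ∣ g - h) : g • x = h • x := by
  rw [← sub_eq_zero, ← sub_smul, smul_eq_zero_of_dvd hx hd]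

theorem lev_mono {a b : ℕ} (h : a ≤ b) : lev A p a ≤ lev A p b := by
  intro x hx
  obtain ⟨c, rfl⟩ := Nat.exists_eq_add_of_le h
  exact mem_lev.2 (smul_eq_zero_of_dvd hx (X_pow_sub_one_dvd a c))

theorem mem_lev_zero {x : A} : x ∈ lev A p 0 ↔ (X - 1 : ℤ[X]) • x = 0 := by
  rw [mem_lev]; simp

theorem smul_lev_zero {x : A} (hx : x ∈ lev A p 0) (g : ℤ[X]) :
    g • x = ((g.eval 1 : ℤ) : ℤ[X]) • x := by
  obtain ⟨Y, hY⟩ := exists_eq_eval_one_add g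
  refine smul_eq_of_dvd_sub hx ?_
  nth_rw 1 [hY]
  simp

theorem relNorm_smul_mem {a c : ℕ} {x : A} (hx : x ∈ lev A p (a + c)) :
    relNorm p a c • x ∈ lev A p a := by
  rw [mem_lev, ← mul_smul, mul_comm, relNorm_mul_sub]
  exact mem_lev.1 hx

theorem relNorm_smul_lev {a : ℕ} {x : A} (hx : x ∈ lev A p a) (c : ℕ) :
    relNorm p a c • x = (p : ℤ[X]) ^ c • x :=
  smul_eq_of_dvd_sub hx (dvd_relNorm_sub a c)

theorem relNorm_zero_mem {a : ℕ} {x : A} (hx : x ∈ lev A p a) :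
    relNorm p 0 a • x ∈ lev A p 0 :=
  relNorm_smul_mem (by simpa using hx)

/-- The formal properties of the multiplicative group of a cyclic extension of degree `p ^ n`
containing a primitive `p`-th root of unity `ζ` fixed by the Galois group. -/
structure KummerModule (p n : ℕ) (ζ : A) : Prop where
  prime : p.Prime
  pos : 0 < n
  mem_top : ∀ x : A, x ∈ lev A p n
  zeta_tors : (p : ℤ[X]) • ζ = 0
  zeta_ne : ζ ≠ 0
  zeta_mem : ζ ∈ lev A p 0
  tors : ∀ x : A, (p : ℤ[X]) • x = 0 → ∃ c : ℤ, x = (c : ℤ[X]) • ζ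
  h90 : ∀ c ≤ n, ∀ x : A, relNorm p c (n - c) • x = 0 → ∃ y : A, x = (X ^ p ^ c - 1 : ℤ[X]) • y

namespace KummerModule

variable {ζ : A}

theorem norm_mem (H : KummerModule p n ζ) (x : A) : relNorm p 0 n • x ∈ lev A p 0 :=
  relNorm_smul_mem (by simpa using H.mem_top x)

theorem norm_smul (H : KummerModule p n ζ) (g : ℤ[X]) (x : A) :
    relNorm p 0 n • g • x = ((g.eval 1 : ℤ) : ℤ[X]) • relNorm p 0 n • x := by
  rw [smul_comm, smul_lev_zero (H.norm_mem x)]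

theorem norm_lev (H : KummerModule p n ζ) {a b : ℕ} (ha : a ≤ b) {x : A} (hx : x ∈ lev A p a) :
    relNorm p 0 b • x = (p : ℤ[X]) ^ (b - a) • relNorm p 0 a • x := by
  obtain ⟨c, rfl⟩ := Nat.exists_eq_add_of_le ha
  rw [← relNorm_mul_relNorm H.prime, mul_smul, zero_add, relNorm_smul_lev hx, smul_comm,
    Nat.add_sub_cancel_left]

/-- Hilbert 90 for the degree `p` layers of the tower. -/
theorem h90_layer (H : KummerModule p n ζ)
    {c : ℕ} (hc : c < n) {x : A} (h : relNorm p c 1 • x = 0) :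
    ∃ y ∈ lev A p (c + 1), x = (X ^ p ^ c - 1 : ℤ[X]) • y := by
  obtain ⟨k, rfl⟩ : ∃ k, n = c + 1 + k := Nat.exists_eq_add_of_le hc
  obtain ⟨y, hy⟩ := H.h90 c (by omega) x (by
    rw [show c + 1 + k - c = 1 + k by omega, ← relNorm_mul_relNorm H.prime, mul_comm, mul_smul, h,
      smul_zero])
  refine ⟨y, mem_lev.2 ?_, hy⟩
  rw [← relNorm_mul_sub, mul_smul, ← hy, h]

theorem descend (H : KummerModule p n ζ) {b : ℕ} (hb : b + 1 ≤ n) {x k : A}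
    (hk : k ∈ lev A p 0) (h : relNorm p 0 (b + 1) • x = (p : ℤ[X]) • k) :
    ∃ y ∈ lev A p (b + 1), ∃ z ∈ lev A p b, x = (X - 1 : ℤ[X]) • y + z := by
  have hmul := relNorm_mul_relNorm H.prime (p := p) 0 b 1
  have h0 := relNorm_mul_sub (p := p) 0 b
  simp only [zero_add, pow_zero, pow_one] at h0 hmul
  obtain ⟨y, hy, hxy⟩ := H.h90_layer (c := b) (by omega) (x := relNorm p 0 b • x - k)
    (by
      rw [smul_sub, relNorm_smul_lev (lev_mono (by omega) hk), ← mul_smul, mul_comm, hmul, h,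
        pow_one, sub_self])
  refine ⟨y, hy, x - (X - 1 : ℤ[X]) • y, mem_lev.2 ?_, by abel⟩
  have h1 := mem_lev_zero.1 hk
  have h2 : (X ^ p ^ b - 1 : ℤ[X]) • (x - (X - 1 : ℤ[X]) • y)
      = (relNorm p 0 b * (X - 1)) • x - (X - 1 : ℤ[X]) • (X ^ p ^ b - 1 : ℤ[X]) • y := by
    rw [h0]; module
  rw [h2, ← hxy]
  linear_combination (norm := module) h1

/-- `N α = p l` with `(σ - 1) l = ζ`. -/
def Root (_ : KummerModule p n ζ) (x : A) : Prop :=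
  ∃ l : A, relNorm p 0 n • x = (p : ℤ[X]) • l ∧ (X - 1 : ℤ[X]) • l = ζ

theorem eq_zero_of_intCast_smul_zeta (H : KummerModule p n ζ)
    {c : ℤ} (h : (c : ℤ[X]) • ζ = 0) : (p : ℤ) ∣ c := by
  by_contra hc
  have hcop : IsCoprime (p : ℤ) c :=
    (Nat.prime_iff_prime_int.1 H.prime).irreducible.coprime_iff_not_dvd.2 hc
  obtain ⟨u, v, huv⟩ := hcop
  have huv' : (u : ℤ[X]) * (p : ℤ[X]) + v * c = 1 := by exact_mod_cast congrArg (Int.cast) huv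
  apply H.zeta_ne
  rw [← one_smul ℤ[X] ζ, ← huv', add_smul, mul_smul, mul_smul, h, H.zeta_tors]
  simp

theorem intCast_smul_zeta (H : KummerModule p n ζ)
    {c : ℤ} (h : (p : ℤ) ∣ c) : (c : ℤ[X]) • ζ = 0 := by
  obtain ⟨k, rfl⟩ := h
  rw [mul_comm]
  push_cast
  rw [mul_smul, H.zeta_tors, smul_zero]

/-- For a root element, `c N α` is `p` times an element of the base only if `p ∣ c`. -/
theorem Root.dvd {H : KummerModule p n ζ}
    {x : A} (hx : H.Root x) {c : ℤ} {f : A} (hf : f ∈ lev A p 0)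
    (h : (c : ℤ[X]) • relNorm p 0 n • x = (p : ℤ[X]) • f) : (p : ℤ) ∣ c := by
  obtain ⟨l, hl, hlζ⟩ := hx
  obtain ⟨b, hb⟩ := H.tors ((c : ℤ[X]) • l - f) (by
    rw [hl] at h
    linear_combination (norm := module) h)
  apply H.eq_zero_of_intCast_smul_zeta
  have h1 := mem_lev_zero.1 hf
  have h2 := mem_lev_zero.1 H.zeta_mem
  rw [← hlζ] at hb h2 ⊢
  linear_combination (norm := module) (X - 1 : ℤ[X]) • hb + h1 + (b : ℤ[X]) • h2

/-- `κ` lies in a proper sublevel of level `b` (or is trivial). -/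
def Low (_ : KummerModule p n ζ) (b : ℕ) (κ : A) : Prop := κ = 0 ∨ ∃ a < b, κ ∈ lev A p a

theorem Root.decompose {H : KummerModule p n ζ}
    {x : A} (hx : H.Root x) {b : ℕ} (hb : b ≤ n) {γ k : A}
    (hγ : γ ∈ lev A p b) (h : relNorm p 0 b • γ = (p : ℤ[X]) • k) :
    ∃ (c : ℤ) (y z κ : A), y ∈ lev A p b ∧ z ∈ lev A p b ∧ H.Low b κ ∧
      γ = (c : ℤ[X]) • relNorm p b (n - b) • x + (X - 1 : ℤ[X]) • y + (p : ℤ[X]) • z + κ := by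
  obtain ⟨l, hl, hlζ⟩ := hx
  have hγ0 := mem_lev_zero.1 (relNorm_zero_mem hγ)
  obtain ⟨c, hc⟩ := H.tors ((X - 1 : ℤ[X]) • k) (by
    rw [h] at hγ0; linear_combination (norm := module) hγ0)
  have hf : k - (c : ℤ[X]) • l ∈ lev A p 0 := by
    rw [mem_lev_zero]
    linear_combination (norm := module) hc - (c : ℤ[X]) • hlζ
  have hS : relNorm p b (n - b) • x ∈ lev A p b :=
    relNorm_smul_mem (by rw [Nat.add_sub_cancel' hb]; exact H.mem_top x)
  have hmul := relNorm_mul_relNorm H.prime (p := p) 0 b (n - b)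
  rw [Nat.add_sub_cancel' hb, zero_add] at hmul
  have hN : relNorm p 0 b • (γ - (c : ℤ[X]) • relNorm p b (n - b) • x)
      = (p : ℤ[X]) • (k - (c : ℤ[X]) • l) := by
    rw [← hmul, mul_smul] at hl
    linear_combination (norm := module) h - (c : ℤ[X]) • hl
  have hγ' : γ - (c : ℤ[X]) • relNorm p b (n - b) • x ∈ lev A p b :=
    sub_mem hγ (Submodule.smul_mem _ _ hS)
  cases b with
  | zero =>
    rw [relNorm_zero_right, one_smul] at hN
    exact ⟨c, 0, k - (c : ℤ[X]) • l, 0, zero_mem _, hf, Or.inl rfl,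
      by linear_combination (norm := module) hN⟩
  | succ b =>
    obtain ⟨y, hy, z, hz, hyz⟩ := H.descend hb hf hN
    exact ⟨c, y, 0, z, hy, zero_mem _, Or.inr ⟨b, by omega, hz⟩,
      by linear_combination (norm := module) hyz⟩

end KummerModule

end Lev

end MSS

namespace MSS

open Polynomial Finset

section Tuple

variable {A : Type*} [AddCommGroup A] [Module ℤ[X] A] {p n : ℕ} {ζ : A}

/-- The polynomials in `σ` giving the norm exponents in the definition of a norm pair. -/
noncomputable def psi (p n : ℕ) : ℕ → ℤ[X]
  | 0 => relNorm p 0 (n - 1)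
  | j + 1 => (p : ℤ[X]) ^ j * relNorm p 0 n

theorem psi_zero : psi p n 0 = relNorm p 0 (n - 1) := rfl

theorem psi_succ (j : ℕ) : psi p n (j + 1) = (p : ℤ[X]) ^ j * relNorm p 0 n := rfl

theorem psi_add (i k : ℕ) : psi p n (i + 1 + k) = psi p n (i + 1) * (p : ℤ[X]) ^ k := by
  rw [show i + 1 + k = i + k + 1 by ring, psi_succ, psi_succ]; ring

theorem sum_range_split {M : Type*} [AddCommMonoid M] (f : ℕ → M) {i N : ℕ} (h : i < N) :
    ∑ j ∈ range N, f j = ∑ j ∈ range i, f j + f i + ∑ j ∈ Ico (i + 1) N, f j := by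
  rw [← sum_range_succ, sum_range_add_sum_Ico _ h]

theorem exists_sum_eq_add (δ : ℕ → A) {i N : ℕ} (h : i < N) :
    ∃ β : A, ∑ j ∈ range N, (p : ℤ[X]) ^ j • δ j =
        ∑ j ∈ range i, (p : ℤ[X]) ^ j • δ j + (p : ℤ[X]) ^ i • δ i + (p : ℤ[X]) ^ (i + 1) • β ∧
      ∑ j ∈ range N, psi p n j • δ j =
        ∑ j ∈ range i, psi p n j • δ j + psi p n i • δ i + psi p n (i + 1) • β := by
  refine ⟨∑ j ∈ Ico (i + 1) N, (p : ℤ[X]) ^ (j - (i + 1)) • δ j, ?_, ?_⟩ <;>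
  · rw [sum_range_split _ h, smul_sum]
    congr 1
    refine sum_congr rfl fun j hj => ?_
    obtain ⟨k, rfl⟩ := Nat.exists_eq_add_of_le (mem_Ico.1 hj).1
    simp [← mul_smul, ← pow_add, psi_add]

theorem sum_smul_single (g : ℕ → ℤ[X]) {i N : ℕ} (h : i < N) (v : A) :
    ∑ j ∈ range N, g j • (if j = i then v else 0) = g i • v := by
  rw [sum_eq_single i (by simp +contextual) (by simp [h])]
  simp

theorem sum_smul_add_single (g : ℕ → ℤ[X]) (δ : ℕ → A) {i N : ℕ} (h : i < N) (v : A) :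
    ∑ j ∈ range N, g j • (δ j + if j = i then v else 0) =
      ∑ j ∈ range N, g j • δ j + g i • v := by
  simp only [smul_add, sum_add_distrib, sum_smul_single g h]

/-- A tuple `(α, δ)` representing a norm pair of length `s + 1` whose norm vector is minimal.
The set `I` consists of the indices of finite level, and `la i` is the level of `δ i`. -/
structure MinTuple (H : KummerModule p n ζ) (s : ℕ) (la : ℕ → ℕ) (I : Set ℕ) (e : ℤ) (α : A)
    (δ : ℕ → A) : Prop where
  pos : 1 ≤ s
  last_mem : s ∈ I
  la_le : ∀ i, la i ≤ n
  la_zero : la 0 < n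
  mem : ∀ i ≤ s, δ i ∈ lev A p (la i)
  zero : ∀ i ≤ s, i ∉ I → δ i = 0
  eqn : (X - (1 + (p : ℤ[X]) * (e : ℤ[X]))) • α = ∑ j ∈ range (s + 2), (p : ℤ[X]) ^ j • δ j
  chi : (e : ℤ[X]) • relNorm p 0 n • α + ∑ j ∈ range (s + 2), psi p n j • δ j = ζ
  min : ∀ i ≤ s, i ∈ I → ∀ (e' : ℤ) (α' : A) (δ' : ℕ → A) (κ β : A),
    (∀ j < i, δ' j ∈ lev A p (la j) ∧ (j ∉ I → δ' j = 0)) → H.Low (la i) κ →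
    (X - (1 + (p : ℤ[X]) * (e' : ℤ[X]))) • α' =
      ∑ j ∈ range i, (p : ℤ[X]) ^ j • δ' j + (p : ℤ[X]) ^ i • κ + (p : ℤ[X]) ^ (i + 1) • β →
    (e' : ℤ[X]) • relNorm p 0 n • α' + ∑ j ∈ range i, psi p n j • δ' j + psi p n i • κ +
      psi p n (i + 1) • β = 0

/-- Elements which can be moved out of slot `i` of a tuple with twist `1 + p e` without affecting
the levels of the earlier entries or the norm condition. -/
def Rem (A : Type*) [AddCommGroup A] [Module ℤ[X] A] (p n : ℕ) (e : ℤ) (i : ℕ) (g : A) : Prop :=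
  ∃ Y z : A, g = (X - (1 + (p : ℤ[X]) * (e : ℤ[X]))) • Y + (p : ℤ[X]) • z ∧
    (p : ℤ[X]) ^ i • (e : ℤ[X]) • relNorm p 0 n • Y + psi p n i • g = psi p n (i + 1) • z

theorem Rem.add {e : ℤ} {i : ℕ} {g h : A} (hg : Rem A p n e i g) (hh : Rem A p n e i h) :
    Rem A p n e i (g + h) := by
  obtain ⟨Y, z, h1, h2⟩ := hg
  obtain ⟨Y', z', h1', h2'⟩ := hh
  exact ⟨Y + Y', z + z', by linear_combination (norm := module) h1 + h1',
    by linear_combination (norm := module) h2 + h2'⟩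

theorem Rem.smul {e : ℤ} {i : ℕ} {g : A} (c : ℤ[X]) (hg : Rem A p n e i g) :
    Rem A p n e i (c • g) := by
  obtain ⟨Y, z, h1, h2⟩ := hg
  exact ⟨c • Y, c • z, by linear_combination (norm := module) c • h1,
    by linear_combination (norm := module) c • h2⟩

theorem Rem.sum {ι : Type*} {e : ℤ} {i : ℕ} (t : Finset ι) (g : ι → A)
    (hg : ∀ j ∈ t, Rem A p n e i (g j)) : Rem A p n e i (∑ j ∈ t, g j) := by
  classical
  induction t using Finset.induction_on with
  | empty => exact ⟨0, 0, by simp, by simp⟩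
  | insert a t ha ih =>
    rw [sum_insert ha]
    exact (hg a (mem_insert_self _ _)).add (ih fun j hj => hg j (mem_insert_of_mem hj))

theorem KummerModule.rem_smul (H : KummerModule p n ζ)
    (e : ℤ) (i : ℕ) {P : ℤ[X]} {q : ℤ} (hP : P.eval 1 = p * q) {x : A}
    (h0 : i = 0 → relNorm p 0 (n - 1) • P • x = (q : ℤ[X]) • relNorm p 0 n • x) :
    Rem A p n e i (P • x) := by
  obtain ⟨Y, hY⟩ := exists_eq_eval_add P (1 + p * e)
  obtain ⟨w, hw⟩ : (p : ℤ) ∣ P.eval (1 + p * e) := by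
    have h1 := P.sub_dvd_eval_sub (1 + p * e) 1
    rw [hP] at h1
    have h2 : (p : ℤ) ∣ P.eval (1 + p * e) - p * q :=
      (Dvd.intro e (by ring)).trans h1
    simpa using dvd_add h2 (dvd_mul_right (p : ℤ) q)
  have hq : q = w - e * Y.eval 1 := by
    have h1 := congrArg (eval 1) hY
    rw [hw, hP] at h1
    simp only [eval_add, eval_mul, eval_intCast, eval_sub, eval_X] at h1
    have hp0 : (p : ℤ) ≠ 0 := by exact_mod_cast H.prime.ne_zero
    apply mul_left_cancel₀ hp0
    push_cast at h1
    linear_combination h1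
  have hY' : P = (p : ℤ[X]) * (w : ℤ[X]) + (X - (1 + (p : ℤ[X]) * (e : ℤ[X]))) * Y := by
    rw [hw] at hY
    push_cast at hY
    exact hY
  have hN : relNorm p 0 n • Y • x = ((Y.eval 1 : ℤ) : ℤ[X]) • relNorm p 0 n • x :=
    H.norm_smul Y x
  have hq' : (q : ℤ[X]) = w - e * ((Y.eval 1 : ℤ) : ℤ[X]) := by rw [hq]; push_cast; rfl
  refine ⟨Y • x, (w : ℤ[X]) • x, by rw [hY']; module, ?_⟩
  cases i with
  | zero =>
    rw [psi_succ, psi_zero, h0 rfl, hN, hq']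
    module
  | succ i =>
    have hNP := H.norm_smul P x
    have hP' : ((P.eval 1 : ℤ) : ℤ[X]) = (p : ℤ[X]) * (w - e * ((Y.eval 1 : ℤ) : ℤ[X])) := by
      rw [hP, hq]; push_cast; rfl
    rw [hP'] at hNP
    rw [psi_succ, psi_succ, mul_smul, hNP, hN]
    module

theorem KummerModule.rem_sub_one (H : KummerModule p n ζ) (e : ℤ) (i : ℕ) {x : A}
    (hx : i = 0 → x ∈ lev A p (n - 1)) : Rem A p n e i ((X - 1 : ℤ[X]) • x) := by
  refine H.rem_smul e i (q := 0) (by simp) fun h => ?_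
  have h1 := relNorm_mul_sub (p := p) 0 (n - 1)
  simp only [pow_zero, pow_one, zero_add] at h1
  rw [← mul_smul, h1, mem_lev.1 (hx h)]
  simp

theorem KummerModule.rem_prime (H : KummerModule p n ζ) (e : ℤ) (i : ℕ) {x : A}
    (hx : i = 0 → x ∈ lev A p (n - 1)) : Rem A p n e i ((p : ℤ[X]) • x) := by
  refine H.rem_smul e i (q := 1) (by simp) fun h => ?_
  have := H.pos
  rw [H.norm_lev (Nat.sub_le n 1) (hx h), show n - (n - 1) = 1 by omega]
  simp only [Int.cast_one]
  module

theorem KummerModule.norm_pred_relNorm (H : KummerModule p n ζ)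
    {a c : ℕ} (hc : 1 ≤ c) (hac : a + c ≤ n) {x : A}
    (hx : x ∈ lev A p (a + c)) :
    relNorm p 0 (n - 1) • relNorm p a c • x = (p : ℤ[X]) ^ (c - 1) • relNorm p 0 n • x := by
  have hmul := relNorm_mul_relNorm H.prime (p := p) 0 a c
  rw [H.norm_lev (a := a) (by omega) (relNorm_smul_mem hx), H.norm_lev hac hx, ← hmul,
    zero_add, show n - 1 - a = c - 1 + (n - (a + c)) by omega, pow_add]
  module

theorem KummerModule.rem_relNorm (H : KummerModule p n ζ)
    (e : ℤ) (i : ℕ) {a c : ℕ} (hc : 1 ≤ c) (hac : a + c ≤ n) {x : A}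
    (hx : x ∈ lev A p (a + c)) : Rem A p n e i (relNorm p a c • x) := by
  refine H.rem_smul e i (q := p ^ (c - 1)) ?_ fun _ => ?_
  · rw [eval_relNorm_one, ← pow_succ', Nat.sub_add_cancel hc]
  · rw [H.norm_pred_relNorm hc hac hx]
    push_cast
    rfl

namespace MinTuple

variable {H : KummerModule p n ζ} {s : ℕ} {la : ℕ → ℕ} {I : Set ℕ} {e : ℤ} {α : A} {δ : ℕ → A}

theorem min_rem (T : MinTuple H s la I e α δ)
    {i : ℕ} (hi : i ≤ s) (hI : i ∈ I) {e' : ℤ} {α' : A} {δ' : ℕ → A} {κ g β : A}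
    (hδ : ∀ j < i, δ' j ∈ lev A p (la j) ∧ (j ∉ I → δ' j = 0)) (hκ : H.Low (la i) κ)
    (hg : Rem A p n e' i g)
    (h : (X - (1 + (p : ℤ[X]) * (e' : ℤ[X]))) • α' = ∑ j ∈ range i, (p : ℤ[X]) ^ j • δ' j +
      (p : ℤ[X]) ^ i • (κ + g) + (p : ℤ[X]) ^ (i + 1) • β) :
    (e' : ℤ[X]) • relNorm p 0 n • α' + ∑ j ∈ range i, psi p n j • δ' j + psi p n i • (κ + g) +
      psi p n (i + 1) • β = 0 := by
  obtain ⟨Y, z, h1, h2⟩ := hg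
  have := T.min i hi hI e' (α' - (p : ℤ[X]) ^ i • Y) δ' κ (β + z) hδ hκ (by
    linear_combination (norm := module) h + (p : ℤ[X]) ^ i • h1)
  linear_combination (norm := module) this + h2

theorem la_zero_lt (T : MinTuple H s la I e α δ) (h : 0 ∈ I) : la 0 + 1 < n := by
  by_contra hcon
  have hla : la 0 = n - 1 := by have := T.la_zero; omega
  have hn := H.pos
  obtain ⟨κ, hκ, hκζ⟩ := H.h90_layer (c := n - 1) (x := ζ) (by omega) (by
    rw [relNorm_smul_lev (lev_mono (Nat.zero_le _) H.zeta_mem), pow_one, H.zeta_tors])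
  have h1 := relNorm_mul_sub (p := p) 0 (n - 1)
  simp only [pow_zero, pow_one, zero_add] at h1
  have hs : 0 < s := T.pos
  have := T.min s le_rfl T.last_mem 0 κ
    (fun j => if j = 0 then (X - 1 : ℤ[X]) • κ else 0) 0 0 (fun j _ => by
      split_ifs with hj
      · subst hj
        refine ⟨?_, fun h' => absurd h h'⟩
        rw [hla, mem_lev, smul_comm, ← hκζ]
        exact mem_lev_zero.1 H.zeta_mem
      · exact ⟨zero_mem _, fun _ => rfl⟩) (Or.inl rfl) (by
      rw [sum_smul_single _ hs]; simp)
  rw [sum_smul_single _ hs, psi_zero, ← mul_smul (relNorm p 0 (n - 1)), h1, ← hκζ] at this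
  apply H.zeta_ne
  simpa using this

theorem exists_norm_pred (T : MinTuple H s la I e α δ) :
    ∃ η ∈ lev A p 0, relNorm p 0 (n - 1) • δ 0 = (p : ℤ[X]) • η := by
  by_cases h : 0 ∈ I
  · have h0 := T.la_zero_lt h
    refine ⟨(p : ℤ[X]) ^ (n - 2 - la 0) • relNorm p 0 (la 0) • δ 0,
      Submodule.smul_mem _ _ (relNorm_zero_mem (T.mem 0 (Nat.zero_le _))), ?_⟩
    rw [H.norm_lev (a := la 0) (by omega) (T.mem 0 (Nat.zero_le _)),
      show n - 1 - la 0 = n - 2 - la 0 + 1 by omega, pow_succ']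
    module
  · exact ⟨0, zero_mem _, by rw [T.zero 0 (Nat.zero_le _) h]; simp⟩

theorem root (T : MinTuple H s la I e α δ) : H.Root α := by
  obtain ⟨β, hβ, hβ'⟩ := exists_sum_eq_add (p := p) (n := n) δ (show 0 < s + 2 by omega)
  obtain ⟨η, hη, hη'⟩ := T.exists_norm_pred
  obtain ⟨Q, hQ⟩ := dvd_relNorm_sub (p := p) (n - 1) 1
  have hn := H.pos
  have hmul := relNorm_mul_relNorm H.prime (p := p) 0 (n - 1) 1
  rw [show n - 1 + 1 = n by omega, zero_add] at hmul
  have h1 := relNorm_mul_sub (p := p) 0 (n - 1)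
  simp only [pow_zero, pow_one, zero_add] at h1
  have heq := T.eqn
  have hchi := T.chi
  rw [hβ] at heq
  rw [hβ'] at hchi
  simp only [range_zero, sum_empty, zero_add, pow_zero, pow_one, one_smul, psi_zero, psi_succ,
    one_mul] at heq hchi
  have hη0 := relNorm_smul_lev (lev_mono (Nat.zero_le (n - 1)) hη) 1
  rw [pow_one] at hη0 hQ
  set M := relNorm p 0 (n - 1)
  set S := relNorm p (n - 1) 1
  rw [← hmul] at hchi
  have hQ' : S = (p : ℤ[X]) + M * (X - 1) * Q := by rw [h1]; linear_combination hQ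
  refine ⟨M • α + Q • M • (M • ((e : ℤ[X]) • α + β) + η), ?_, ?_⟩
  · rw [← hmul, hQ']
    linear_combination (norm := module) (Q * M * M) • heq + (Q * M) • hη'
  · rw [hQ'] at hchi hη0
    linear_combination (norm := module) hchi + M • heq + hη0

theorem la_lt (T : MinTuple H s la I e α δ)
    {i j : ℕ} (hij : i < j) (hj : j ≤ s) (hi : i ∈ I) (hjI : j ∈ I) : la i < la j := by
  by_contra hcon
  obtain ⟨β, hβ, hβ'⟩ := exists_sum_eq_add (p := p) (n := n) δ (show j < s + 2 by omega)
  have hmem : δ j ∈ lev A p (la i) := lev_mono (by omega) (T.mem j hj)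
  have hpsi : psi p n j • δ j = psi p n i • (p : ℤ[X]) ^ (j - i) • δ j := by
    obtain ⟨k, rfl⟩ := Nat.exists_eq_add_of_le hij
    cases i with
    | zero =>
      have hn := H.pos
      have := T.la_zero
      rw [show 0 + 1 + k = k + 1 by ring, psi_succ, psi_zero, mul_smul,
        H.norm_lev (Nat.sub_le n 1) (lev_mono (by omega) (show 0 + 1 + k = k + 1 by ring ▸ hmem)),
        show n - (n - 1) = 1 by omega, show k + 1 - 0 = k + 1 by omega]
      module
    | succ i =>
      rw [show i + 1 + 1 + k = i + 1 + (k + 1) by ring, psi_add, mul_smul,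
        show i + 1 + (k + 1) - (i + 1) = k + 1 by omega]
  have := T.min j hj hjI e α (fun k => δ k + if k = i then (p : ℤ[X]) ^ (j - i) • δ j else 0) 0 β
    (fun k hk => by
      split_ifs with h
      · subst h
        exact ⟨add_mem (T.mem k (by omega)) (Submodule.smul_mem _ _ hmem), fun h' => absurd hi h'⟩
      · rw [add_zero]
        exact ⟨T.mem k (by omega), T.zero k (by omega)⟩) (Or.inl rfl) (by
      rw [T.eqn, hβ, sum_smul_add_single _ _ hij, ← mul_smul, ← pow_add,
        Nat.add_sub_cancel' hij.le]
      module)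
  rw [sum_smul_add_single _ _ hij, ← hpsi] at this
  apply H.zeta_ne
  rw [← T.chi, hβ', ← this]
  module

end MinTuple

end Tuple

end MSS

namespace MSS

open Polynomial Finset

section Indep

variable {A : Type*} [AddCommGroup A] [Module ℤ[X] A] {p n : ℕ} {ζ : A}

variable (A) in
/-- The submodule `qA`. -/
noncomputable def mulRange (q : ℤ[X]) : Submodule ℤ[X] A :=
  LinearMap.range (LinearMap.lsmul ℤ[X] A q)

theorem mem_mulRange {q : ℤ[X]} {x : A} : x ∈ mulRange A q ↔ ∃ k : A, q • k = x := Iff.rfl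

theorem smul_mem_mulRange (q : ℤ[X]) (x : A) : q • x ∈ mulRange A q := ⟨x, rfl⟩

theorem mulRange_mono {q r : ℤ[X]} (h : q ∣ r) : mulRange A r ≤ mulRange A q := by
  rintro _ ⟨x, rfl⟩
  obtain ⟨t, rfl⟩ := h
  exact ⟨t • x, (mul_smul _ _ _).symm⟩

variable (A) in
/-- The submodule `p A_0` where `A_0` is the submodule of fixed elements. -/
noncomputable def baseRange (p : ℕ) : Submodule ℤ[X] A :=
  (lev A p 0).map (LinearMap.lsmul ℤ[X] A (p : ℤ[X]))

theorem mem_baseRange {x : A} : x ∈ baseRange A p ↔ ∃ f ∈ lev A p 0, (p : ℤ[X]) • f = x := Iff.rfl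

theorem smul_mem_baseRange {f : A} (hf : f ∈ lev A p 0) : (p : ℤ[X]) • f ∈ baseRange A p :=
  ⟨f, hf, rfl⟩

theorem intCast_smul_mem_baseRange {c : ℤ} (hc : (p : ℤ) ∣ c) {f : A} (hf : f ∈ lev A p 0) :
    (c : ℤ[X]) • f ∈ baseRange A p := by
  obtain ⟨k, rfl⟩ := hc
  push_cast
  rw [mul_smul]
  exact smul_mem_baseRange (Submodule.smul_mem _ _ hf)

/-- The ideal of polynomials acting on elements of level `a` through multiples of `p`. -/
noncomputable def levIdeal (p a : ℕ) : Ideal ℤ[X] := Ideal.span {(p : ℤ[X]), X ^ p ^ a - 1}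

theorem mem_levIdeal {a : ℕ} {g : ℤ[X]} :
    g ∈ levIdeal p a ↔ ∃ u v, g = (p : ℤ[X]) * u + (X ^ p ^ a - 1) * v := by
  rw [levIdeal, Ideal.mem_span_pair]
  exact ⟨fun ⟨u, v, h⟩ => ⟨u, v, by rw [← h]; ring⟩, fun ⟨u, v, h⟩ => ⟨u, v, by rw [h]; ring⟩⟩

theorem exists_smul_eq_of_mem_levIdeal {a : ℕ} {g : ℤ[X]} (h : g ∈ levIdeal p a) :
    ∃ u : ℤ[X], ∀ x ∈ lev A p a, g • x = (p : ℤ[X]) • u • x := by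
  obtain ⟨u, v, rfl⟩ := mem_levIdeal.1 h
  refine ⟨u, fun x hx => ?_⟩
  rw [← mul_smul]
  exact smul_eq_of_dvd_sub hx ⟨v, by ring⟩

theorem X_sub_one_pow_mem_levIdeal (hp : p.Prime) {a : ℕ} (ha : a ≤ n) :
    (X - 1 : ℤ[X]) ^ p ^ n ∈ levIdeal p a := by
  obtain ⟨u, hu⟩ := X_sub_one_pow_mem hp n
  obtain ⟨c, rfl⟩ := Nat.exists_eq_add_of_le ha
  exact mem_levIdeal.2 ⟨u, relNorm p a c, by rw [hu, mul_comm (X ^ p ^ a - 1), relNorm_mul_sub]⟩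

theorem KummerModule.mem_mulRange_of_pow_smul_eq_zero (H : KummerModule p n ζ) {ν : ℕ}
    (h : ζ ∈ mulRange A ((p : ℤ[X]) ^ ν)) {x : A} (hx : (p : ℤ[X]) ^ ν • x = 0) :
    x ∈ mulRange A (p : ℤ[X]) := by
  induction ν generalizing x with
  | zero =>
    rw [pow_zero, one_smul] at hx
    rw [hx]; exact zero_mem _
  | succ ν ih =>
    obtain ⟨c, hc⟩ := H.tors ((p : ℤ[X]) ^ ν • x) (by rw [← hx, pow_succ]; module)
    obtain ⟨y, hy⟩ := mem_mulRange.1 h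
    have h1 := ih (mulRange_mono (pow_dvd_pow _ (Nat.le_succ ν)) h)
      (x := x - (p : ℤ[X]) • (c : ℤ[X]) • y) (by
        rw [smul_sub, hc, ← hy, pow_succ]; module)
    simpa using add_mem h1 (smul_mem_mulRange (p : ℤ[X]) ((c : ℤ[X]) • y))

namespace MinTuple

variable {H : KummerModule p n ζ} {s : ℕ} {la : ℕ → ℕ} {I : Set ℕ} {e : ℤ} {α : A} {δ : ℕ → A}

theorem la_lt_top (T : MinTuple H s la I e α δ) {i : ℕ} (hi : i < s) (hI : i ∈ I) : la i < n :=
  (T.la_lt hi le_rfl hI T.last_mem).trans_le (T.la_le s)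

theorem relNorm_mem (T : MinTuple H s la I e α δ)
    {i j : ℕ} (hij : i < j) (hj : j ≤ s) (hi : i ∈ I) :
    relNorm p (la i) (la j - la i) • δ j ∈ lev A p (la i) := by
  by_cases hjI : j ∈ I
  · apply relNorm_smul_mem
    rw [Nat.add_sub_cancel' (T.la_lt hij hj hi hjI).le]
    exact T.mem j hj
  · rw [T.zero j hj hjI, smul_zero]
    exact zero_mem _

theorem relNorm_relNorm (T : MinTuple H s la I e α δ)
    {i j : ℕ} (hij : i < j) (hj : j ≤ s) (hi : i ∈ I) :
    relNorm p 0 (la i) • relNorm p (la i) (la j - la i) • δ j = relNorm p 0 (la j) • δ j := by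
  by_cases hjI : j ∈ I
  · have h := relNorm_mul_relNorm H.prime (p := p) 0 (la i) (la j - la i)
    rw [zero_add, Nat.add_sub_cancel' (T.la_lt hij hj hi hjI).le] at h
    rw [← mul_smul, h]
  · rw [T.zero j hj hjI]; simp

theorem rem_relNorm (T : MinTuple H s la I e α δ)
    {i j : ℕ} (hij : i < j) (hj : j ≤ s) (hi : i ∈ I) (e' : ℤ) :
    Rem A p n e' i (relNorm p (la i) (la j - la i) • δ j) := by
  by_cases hjI : j ∈ I
  · have h1 := T.la_lt hij hj hi hjI
    have h2 := T.la_le j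
    exact H.rem_relNorm e' i (by omega) (by omega)
      (by rw [Nat.add_sub_cancel' h1.le]; exact T.mem j hj)
  · rw [T.zero j hj hjI, smul_zero]
    exact ⟨0, 0, by simp, by simp⟩

theorem not_decompose (T : MinTuple H s la I e α δ)
    {i : ℕ} (hi : i ≤ s) (hI : i ∈ I) {c : ℤ} {y z κ t : A}
    (hy : y ∈ lev A p (la i)) (hz : z ∈ lev A p (la i)) (hκ : H.Low (la i) κ)
    (ht : ∀ e' : ℤ, Rem A p n e' i t)
    (h : δ i = (c : ℤ[X]) • relNorm p (la i) (n - la i) • α + (X - 1 : ℤ[X]) • y +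
      (p : ℤ[X]) • z + κ + t) : False := by
  obtain ⟨β, hβ, hβ'⟩ := exists_sum_eq_add (p := p) (n := n) δ (show i < s + 2 by omega)
  have hlow : i = 0 → lev A p (la i) ≤ lev A p (n - 1) := by
    rintro rfl
    have := T.la_zero
    exact lev_mono (by omega)
  have hrem : ∀ e' : ℤ, Rem A p n e' i ((X - 1 : ℤ[X]) • y + (p : ℤ[X]) • z + t) := fun e' =>
    ((H.rem_sub_one e' i fun h0 => hlow h0 hy).add (H.rem_prime e' i fun h0 => hlow h0 hz)).add
      (ht e')
  have hδ : ∀ j < i, δ j ∈ lev A p (la j) ∧ (j ∉ I → δ j = 0) :=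
    fun j hj => ⟨T.mem j (by omega), T.zero j (by omega)⟩
  apply H.zeta_ne
  rcases (T.la_le i).lt_or_eq with hlt | htop
  · have hrem' : Rem A p n e i ((X - 1 : ℤ[X]) • y + (p : ℤ[X]) • z + t +
        (c : ℤ[X]) • relNorm p (la i) (n - la i) • α) :=
      (hrem e).add (.smul _ (H.rem_relNorm e i (by omega) (by omega)
        (by rw [Nat.add_sub_cancel' hlt.le]; exact H.mem_top α)))
    have hsum : κ + ((X - 1 : ℤ[X]) • y + (p : ℤ[X]) • z + t +
        (c : ℤ[X]) • relNorm p (la i) (n - la i) • α) = δ i := by rw [h]; abel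
    have := T.min_rem hi hI (α' := α) (β := β) hδ hκ hrem' (by rw [hsum, T.eqn, hβ])
    rw [hsum] at this
    rw [← T.chi, hβ', ← this]
    abel
  · cases i with
    | zero => have := T.la_zero; omega
    | succ i =>
      rw [htop, Nat.sub_self, relNorm_zero_right, one_smul] at h
      have := T.min_rem hi hI (e' := e + p ^ i * c) (α' := α) (β := β) hδ hκ (hrem _) (by
        have := T.eqn
        rw [hβ] at this
        push_cast
        linear_combination (norm := module) this + (p : ℤ[X]) ^ (i + 1) • h)
      have hchi := T.chi
      rw [hβ'] at hchi
      rw [psi_succ] at *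
      push_cast at this
      linear_combination (norm := module) this - hchi + ((p : ℤ[X]) ^ i * relNorm p 0 n) • h

/-- Modulo `p`, the norms of the `δ i` to the base are linearly independent. -/
theorem dvd_of_sum_norm_mem (T : MinTuple H s la I e α δ) {c : ℕ → ℤ}
    (h : ∑ j ∈ range (s + 1), (c j : ℤ[X]) • relNorm p 0 (la j) • δ j ∈ mulRange A (p : ℤ[X]))
    {i : ℕ} (hi : i ≤ s) (hI : i ∈ I) : (p : ℤ) ∣ c i := by
  induction i using Nat.strong_induction_on with
  | _ i ih =>
  by_contra hc
  obtain ⟨v, u, huv⟩ : IsCoprime (p : ℤ) (c i) :=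
    (Nat.prime_iff_prime_int.1 H.prime).irreducible.coprime_iff_not_dvd.2 hc
  have huv' : (v : ℤ[X]) * (p : ℤ[X]) + u * c i = 1 := by exact_mod_cast congrArg (Int.cast) huv
  rw [sum_range_split _ (show i < s + 1 by omega)] at h
  have hlt : ∑ j ∈ range i, (c j : ℤ[X]) • relNorm p 0 (la j) • δ j ∈ mulRange A (p : ℤ[X]) := by
    refine sum_mem fun j hj => ?_
    have hj := mem_range.1 hj
    by_cases hjI : j ∈ I
    · obtain ⟨k, hk⟩ := ih j hj (by omega) hjI
      rw [hk]; push_cast; rw [mul_smul]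
      exact smul_mem_mulRange _ _
    · rw [T.zero j (by omega) hjI]; simp
  set t : A := ∑ j ∈ Ico (i + 1) (s + 1),
    ((u * c j : ℤ) : ℤ[X]) • relNorm p (la i) (la j - la i) • δ j with ht
  have hγ : δ i + t ∈ lev A p (la i) := by
    refine add_mem (T.mem i hi) (sum_mem fun j hj => Submodule.smul_mem _ _ ?_)
    have hj := mem_Ico.1 hj
    exact T.relNorm_mem (by omega) (by omega) hI
  have hNt : relNorm p 0 (la i) • t =
      (u : ℤ[X]) • ∑ j ∈ Ico (i + 1) (s + 1), (c j : ℤ[X]) • relNorm p 0 (la j) • δ j := by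
    rw [ht, smul_sum, smul_sum]
    refine sum_congr rfl fun j hj => ?_
    have hj := mem_Ico.1 hj
    rw [smul_comm, T.relNorm_relNorm (by omega) (by omega) hI]
    push_cast
    rw [mul_smul]
  obtain ⟨k, hk⟩ := mem_mulRange.1 h
  obtain ⟨k', hk'⟩ := mem_mulRange.1 hlt
  obtain ⟨b, y, z, κ, hy, hz, hκ, hdec⟩ := T.root.decompose (T.la_le i) hγ
    (k := (u : ℤ[X]) • (k - k') + (v : ℤ[X]) • relNorm p 0 (la i) • δ i) (by
      rw [smul_add, hNt]
      rw [← hk'] at hk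
      linear_combination (norm := module)
        -(u : ℤ[X]) • hk - huv' • (relNorm p 0 (la i) • δ i))
  refine T.not_decompose hi hI hy hz hκ (t := -t) (fun e' => ?_)
    (by linear_combination (norm := module) hdec)
  rw [ht, ← neg_one_smul ℤ[X]]
  refine .smul _ (.sum _ _ fun j hj => .smul _ ?_)
  have hj := mem_Ico.1 hj
  exact T.rem_relNorm (by omega) (by omega) hI e'

theorem le_of_good (T : MinTuple H s la I e α δ)
    {i : ℕ} (hi : i < s) (hI : i ∈ I) (hgood : p = 2 → (2 : ℤ) ∣ e ∨ 1 ≤ la i) :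
    s + la i ≤ i + n := by
  by_contra hcon
  have hlt := T.la_lt hi le_rfl hI T.last_mem
  have hle := T.la_le s
  obtain ⟨c, hc⟩ := Nat.exists_eq_add_of_le hlt.le
  obtain ⟨r, hr⟩ : ∃ r, s = i + c + r := Nat.exists_eq_add_of_le (by omega)
  obtain ⟨u, hu, hpu⟩ := exists_geom_sum_eq_mul H.prime (d := 1 + p * e) ⟨e, by ring⟩ (la i) (by
    rintro rfl
    refine (hgood rfl).imp (fun ⟨k, hk⟩ => ⟨k, ?_⟩) id
    rw [hk]; push_cast; ring) c
  obtain ⟨Y, hY⟩ := exists_eq_eval_add (relNorm p (la i) c) (1 + p * e)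
  have hY1 : (p : ℤ) ^ c = p ^ c * u - p * (e * Y.eval 1) := by
    have := congrArg (eval 1) hY
    rw [eval_relNorm_one, hu] at this
    simp only [eval_add, eval_mul, eval_intCast, eval_sub, eval_X] at this
    push_cast at this
    linear_combination this
  rw [hu] at hY
  set x := (p : ℤ[X]) ^ r • δ s with hx
  have hxmem : x ∈ lev A p (la i + c) := Submodule.smul_mem _ _ (hc ▸ T.mem s le_rfl)
  have hNY := H.norm_smul Y x
  have hkey : (p : ℤ[X]) ^ i • (e : ℤ[X]) • relNorm p 0 n • Y • x +
      psi p n i • relNorm p (la i) c • x = (u : ℤ[X]) • psi p n s • δ s := by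
    rw [hNY]
    cases i with
    | zero =>
      obtain ⟨c, rfl⟩ : ∃ c', c = c' + 1 := ⟨c - 1, by omega⟩
      rw [psi_zero, H.norm_pred_relNorm (by omega) (by omega) hxmem,
        show psi p n s = _ from (congrArg _ (show s = c + r + 1 by omega)).trans (psi_succ _),
        Nat.add_sub_cancel, hx]
      have hY2 : (p : ℤ) ^ c + e * Y.eval 1 = p ^ c * u := by
        have hp0 : (p : ℤ) ≠ 0 := by exact_mod_cast H.prime.ne_zero
        apply mul_left_cancel₀ hp0
        linear_combination hY1
      have hY3 : (p : ℤ[X]) ^ c + e * ((Y.eval 1 : ℤ) : ℤ[X]) = p ^ c * u := by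
        exact_mod_cast congrArg (Int.cast (R := ℤ[X])) hY2
      linear_combination (norm := module) hY3 • (relNorm p 0 n • (p : ℤ[X]) ^ r • δ s)
    | succ i =>
      rw [psi_succ, mul_smul, H.norm_smul (relNorm p _ c), eval_relNorm_one,
        show psi p n s = _ from (congrArg _ (show s = i + c + r + 1 by omega)).trans (psi_succ _),
        hx]
      have hY3 : (((p : ℤ) ^ c : ℤ) : ℤ[X]) = p ^ c * u - p * (e * ((Y.eval 1 : ℤ) : ℤ[X])) := by
        rw [hY1]; push_cast; rfl
      rw [hY3]
      module
  obtain ⟨β, hβ, hβ'⟩ := exists_sum_eq_add (p := p) (n := n) δ (show s < s + 2 by omega)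
  have heq := T.eqn
  have hchi := T.chi
  rw [hβ] at heq
  rw [hβ'] at hchi
  have hpow : (p : ℤ[X]) ^ s = p ^ i * p ^ c * p ^ r := by rw [hr]; ring
  have hYx : relNorm p (la i) c • x = ((p : ℤ[X]) ^ c * (u : ℤ[X])) • x +
      (X - (1 + (p : ℤ[X]) * (e : ℤ[X]))) • Y • x := by
    nth_rw 1 [hY]
    push_cast
    module
  have := T.min s le_rfl T.last_mem e ((u : ℤ[X]) • α + (p : ℤ[X]) ^ i • Y • x)
    (fun k => (u : ℤ[X]) • δ k + if k = i then relNorm p (la i) c • x else 0) 0 ((u : ℤ[X]) • β)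
    (fun k hk => by
      split_ifs with h
      · subst h
        exact ⟨add_mem (Submodule.smul_mem _ _ (T.mem k (by omega))) (relNorm_smul_mem hxmem),
          fun h' => absurd hI h'⟩
      · rw [add_zero]
        exact ⟨Submodule.smul_mem _ _ (T.mem k (by omega)),
          fun h' => by rw [T.zero k (by omega) h', smul_zero]⟩) (Or.inl rfl) (by
      rw [sum_smul_add_single _ (fun k => (u : ℤ[X]) • δ k) hi, hYx]
      simp only [smul_comm _ (u : ℤ[X]) (δ _)]
      rw [← smul_sum, hx]
      linear_combination (norm := module) (u : ℤ[X]) • heq + (u : ℤ[X]) • hpow • δ s)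
  rw [sum_smul_add_single _ (fun k => (u : ℤ[X]) • δ k) hi] at this
  simp only [smul_comm _ (u : ℤ[X]) (δ _)] at this
  rw [← smul_sum] at this
  apply hpu
  apply H.eq_zero_of_intCast_smul_zeta
  linear_combination (norm := module) this - (u : ℤ[X]) • hchi - hkey

theorem norm_smul_mem_baseRange (T : MinTuple H s la I e α δ) {i : ℕ} (hi : i ≤ s) (h : la i < n) :
    relNorm p 0 n • δ i ∈ baseRange A p := by
  obtain ⟨k, hk⟩ := Nat.exists_eq_add_of_lt h
  rw [H.norm_lev h.le (T.mem i hi), show n - la i = k + 1 by omega, pow_succ', mul_smul]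
  exact smul_mem_baseRange (Submodule.smul_mem _ _ (relNorm_zero_mem (T.mem i hi)))

theorem mem_levIdeal_of_sum_mem (T : MinTuple H s la I e α δ) {g : ℕ → ℤ[X]}
    (h : ∑ j ∈ range (s + 1), g j • δ j ∈ mulRange A (p : ℤ[X])) {i : ℕ} (hi : i ≤ s)
    (hI : i ∈ I) : g i ∈ levIdeal p (la i) := by
  suffices ∀ N, ∀ g : ℕ → ℤ[X], ∑ j ∈ range (s + 1), g j • δ j ∈ mulRange A (p : ℤ[X]) →
      (∀ j ≤ s, j ∈ I → (X - 1) ^ N * g j ∈ levIdeal p (la j)) →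
      ∀ j ≤ s, j ∈ I → g j ∈ levIdeal p (la j) from
    this (p ^ n) g h (fun j _ _ => Ideal.mul_mem_right _ _
      (X_sub_one_pow_mem_levIdeal H.prime (T.la_le j))) i hi hI
  intro N
  induction N with
  | zero => intro g _ hg; simpa using hg
  | succ N ih =>
    intro g h hg
    have h1 := ih (fun j => (X - 1) * g j) (by
      simp only [mul_smul, ← smul_sum]
      exact Submodule.smul_mem _ _ h) (fun j hj hjI => by
        rw [← mul_assoc, ← pow_succ]; exact hg j hj hjI)
    have h2 : ∀ j, ∃ c : ℤ, j ≤ s → j ∈ I →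
        g j - (c : ℤ[X]) * relNorm p 0 (la j) ∈ levIdeal p (la j) := fun j => by
      by_cases hj : j ≤ s ∧ j ∈ I
      · obtain ⟨u, v, huv⟩ := mem_levIdeal.1 (h1 j hj.1 hj.2)
        obtain ⟨c, u', v', h'⟩ := X_sub_one_mul_mem H.prime (la j) huv
        exact ⟨c, fun _ _ => mem_levIdeal.2 ⟨u', v', by rw [h']; ring⟩⟩
      · exact ⟨0, fun h1 h2 => absurd ⟨h1, h2⟩ hj⟩
    choose c hc using h2
    have h3 : ∑ j ∈ range (s + 1), (c j : ℤ[X]) • relNorm p 0 (la j) • δ j ∈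
        mulRange A (p : ℤ[X]) := by
      have h4 : ∑ j ∈ range (s + 1), (g j - (c j : ℤ[X]) * relNorm p 0 (la j)) • δ j ∈
          mulRange A (p : ℤ[X]) := by
        refine sum_mem fun j hj => ?_
        have hj := Nat.lt_succ_iff.1 (mem_range.1 hj)
        by_cases hjI : j ∈ I
        · obtain ⟨u, hu⟩ := exists_smul_eq_of_mem_levIdeal (A := A) (hc j hj hjI)
          rw [hu _ (T.mem j hj)]
          exact smul_mem_mulRange _ _
        · rw [T.zero j hj hjI, smul_zero]; exact zero_mem _
      have := sub_mem h h4
      rw [← sum_sub_distrib] at this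
      refine (congrArg (· ∈ mulRange A (p : ℤ[X])) (sum_congr rfl fun j _ => ?_)).mp this
      module
    intro j hj hjI
    obtain ⟨k, hk⟩ := T.dvd_of_sum_norm_mem h3 hj hjI
    have h5 := hc j hj hjI
    rw [hk] at h5
    have h6 : ((p * k : ℤ) : ℤ[X]) * relNorm p 0 (la j) ∈ levIdeal p (la j) :=
      mem_levIdeal.2 ⟨(k : ℤ[X]) * relNorm p 0 (la j), 0, by push_cast; ring⟩
    simpa using add_mem h5 h6

theorem norm_sum_mem (T : MinTuple H s la I e α δ) {g : ℕ → ℤ[X]} {c : ℤ}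
    (h : (c : ℤ[X]) • α + ∑ j ∈ range (s + 1), g j • δ j ∈ mulRange A (p : ℤ[X])) :
    (p : ℤ) ∣ c := by
  obtain ⟨z, hz⟩ := mem_mulRange.1 h
  have hlow : ∀ i < s, relNorm p 0 n • g i • δ i ∈ baseRange A p := fun i hi => by
    by_cases hI : i ∈ I
    · rw [smul_comm]
      exact Submodule.smul_mem _ _ (T.norm_smul_mem_baseRange hi.le (T.la_lt_top hi hI))
    · rw [T.zero i hi.le hI, smul_zero, smul_zero]; exact zero_mem _
  have hbase : baseRange A p ≤ mulRange A (p : ℤ[X]) := by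
    rintro _ ⟨f, _, rfl⟩; exact smul_mem_mulRange _ _
  have hN := congrArg (relNorm p 0 n • ·) hz
  simp only [smul_add, smul_sum, sum_range_succ] at hN
  have hsum : ∑ i ∈ range s, relNorm p 0 n • g i • δ i ∈ baseRange A p :=
    sum_mem fun i hi => hlow i (mem_range.1 hi)
  have htop : relNorm p 0 n • g s • δ s ∈ baseRange A p := by
    rcases (T.la_le s).lt_or_eq with hlt | htop
    · rw [smul_comm]
      exact Submodule.smul_mem _ _ (T.norm_smul_mem_baseRange le_rfl hlt)
    · rw [H.norm_smul]
      refine intCast_smul_mem_baseRange ?_ (H.norm_mem _)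
      have := T.dvd_of_sum_norm_mem (c := fun j => if j = s then (g s).eval 1 else 0) (by
        rw [sum_eq_single s (by simp +contextual) (by simp)]
        simp only [if_true]
        rw [htop, ← H.norm_smul]
        obtain ⟨l, hl, -⟩ := T.root
        have h1 : relNorm p 0 n • (c : ℤ[X]) • α ∈ mulRange A (p : ℤ[X]) :=
          ⟨(c : ℤ[X]) • l, by rw [smul_comm _ _ α, hl]; exact smul_comm _ _ _⟩
        have h2 : relNorm p 0 n • (p : ℤ[X]) • z ∈ mulRange A (p : ℤ[X]) :=
          ⟨relNorm p 0 n • z, smul_comm _ _ _⟩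
        have := sub_mem (sub_mem h2 h1) (hbase hsum)
        rw [hN] at this
        convert this using 1
        abel) le_rfl T.last_mem
      simpa using this
  obtain ⟨f, hf, hf'⟩ := mem_baseRange.1 (add_mem hsum htop)
  refine T.root.dvd (f := relNorm p 0 n • z - f) (sub_mem (H.norm_mem _) hf) ?_
  rw [← hf'] at hN
  linear_combination (norm := module) -hN

end MinTuple

end Indep

end MSS

namespace MSS

open Polynomial Finset

section TwistPoly

variable {p n : ℕ}

/-- The polynomial `(X ^ p ^ a - d ^ p ^ a) / (X - d)`. -/
noncomputable def twistNorm (p a : ℕ) (d : ℤ) : ℤ[X] :=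
  ∑ t ∈ range (p ^ a), X ^ t * (d : ℤ[X]) ^ (p ^ a - 1 - t)

theorem twistNorm_mul (a : ℕ) (d : ℤ) :
    twistNorm p a d * (X - (d : ℤ[X])) = X ^ p ^ a - (d : ℤ[X]) ^ p ^ a :=
  (Commute.all _ _).geom_sum₂_mul _

theorem twistNorm_zero (d : ℤ) : twistNorm p 0 d = 1 := by simp [twistNorm]

theorem dvd_relNorm_sub_twistNorm {d : ℤ} (hd : (p : ℤ) ∣ d - 1) (a : ℕ) :
    (p : ℤ[X]) ∣ relNorm p 0 a - twistNorm p a d := by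
  have h : relNorm p 0 a - twistNorm p a d =
      ∑ t ∈ range (p ^ a), X ^ t * (1 - (d : ℤ[X]) ^ (p ^ a - 1 - t)) := by
    simp [relNorm, twistNorm, mul_sub]
  rw [h]
  refine dvd_sum fun t _ => Dvd.dvd.mul_left ?_ _
  have h1 : (p : ℤ) ∣ 1 - d ^ (p ^ a - 1 - t) := by
    rw [dvd_sub_comm]
    exact hd.trans (by simpa using sub_dvd_pow_sub_pow d 1 (p ^ a - 1 - t))
  obtain ⟨k, hk⟩ := h1
  exact ⟨(k : ℤ[X]), by exact_mod_cast congrArg (Int.cast (R := ℤ[X])) hk⟩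

theorem dvd_twistNorm_sub (d : ℤ) (a c : ℕ) :
    (X ^ p ^ a - 1 : ℤ[X]) ∣ twistNorm p (a + c) d -
      (((relNorm p a c).eval d : ℤ) : ℤ[X]) * twistNorm p a d := by
  set G : ℤ[X] := ∑ t ∈ range (p ^ c), (X ^ p ^ a) ^ t * ((d : ℤ[X]) ^ p ^ a) ^ (p ^ c - 1 - t)
    with hG
  have hX : (X - (d : ℤ[X])) ≠ 0 := by simpa using X_sub_C_ne_zero d
  have h1 : twistNorm p (a + c) d = G * twistNorm p a d := by
    apply mul_right_cancel₀ hX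
    rw [mul_assoc, twistNorm_mul, twistNorm_mul, hG, (Commute.all _ _).geom_sum₂_mul, ← pow_mul,
      ← pow_mul, ← pow_add]
  have h2 : (((relNorm p a c).eval d : ℤ) : ℤ[X]) =
      ∑ t ∈ range (p ^ c), ((d : ℤ[X]) ^ p ^ a) ^ (p ^ c - 1 - t) := by
    rw [eval_relNorm, sum_range_reflect (fun t => ((d : ℤ[X]) ^ p ^ a) ^ t) (p ^ c)]
    push_cast
    rfl
  rw [h1, h2, ← sub_mul, hG, ← sum_sub_distrib]
  refine Dvd.dvd.mul_right (dvd_sum fun t _ => ?_) _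
  rw [← sub_one_mul]
  exact Dvd.dvd.mul_right (by simpa using sub_dvd_pow_sub_pow (X ^ p ^ a : ℤ[X]) 1 t) _

end TwistPoly

theorem exists_eq_pow_mul_not_dvd {p : ℕ} (hp : p.Prime) {c : ℤ} (hc : c ≠ 0) :
    ∃ (v : ℕ) (u : ℤ), ¬ (p : ℤ) ∣ u ∧ c = p ^ v * u := by
  obtain ⟨u, h1, h2⟩ := FiniteMultiplicity.exists_eq_pow_mul_and_not_dvd
    (Int.finiteMultiplicity_iff.2 ⟨by simpa using hp.ne_one, hc⟩ : FiniteMultiplicity (p : ℤ) c)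
  exact ⟨_, u, h2, h1⟩

section Torsion

variable {A : Type*} [AddCommGroup A] [Module ℤ[X] A] {p n : ℕ} {ζ : A}

namespace KummerModule

theorem exists_zeta_eq (H : KummerModule p n ζ) {θ : A} (hθ : θ ≠ 0) (hp : (p : ℤ[X]) • θ = 0) :
    ∃ c : ℤ, ζ = (c : ℤ[X]) • θ := by
  obtain ⟨c, hc⟩ := H.tors θ hp
  have hpc : ¬ (p : ℤ) ∣ c := fun h => hθ (by rw [hc, H.intCast_smul_zeta h])
  obtain ⟨v, u, huv⟩ : IsCoprime (p : ℤ) c :=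
    (Nat.prime_iff_prime_int.1 H.prime).irreducible.coprime_iff_not_dvd.2 hpc
  have huv' : (v : ℤ[X]) * (p : ℤ[X]) + u * c = 1 := by exact_mod_cast congrArg (Int.cast) huv
  refine ⟨u, ?_⟩
  rw [hc]
  linear_combination (norm := module) (v : ℤ[X]) • H.zeta_tors - huv' • ζ

theorem exists_eq_smul_of_torsion (H : KummerModule p n ζ)
    {t : ℕ} {θ : A} (h : (p : ℤ[X]) ^ t • θ ≠ 0)
    (h' : (p : ℤ[X]) ^ (t + 1) • θ = 0) {x : A} (hx : (p : ℤ[X]) ^ (t + 1) • x = 0) :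
    ∃ b : ℤ, x = (b : ℤ[X]) • θ := by
  induction t generalizing θ x with
  | zero =>
    simp only [zero_add, pow_one, pow_zero, one_smul] at h h' hx
    obtain ⟨c, hc⟩ := H.exists_zeta_eq h h'
    obtain ⟨b, hb⟩ := H.tors x hx
    exact ⟨b * c, by push_cast; rw [hb, hc]; module⟩
  | succ t ih =>
    obtain ⟨b, hb⟩ := ih (θ := (p : ℤ[X]) • θ) (x := (p : ℤ[X]) • x)
      (by rwa [← mul_smul, ← pow_succ]) (by rwa [← mul_smul, ← pow_succ])
      (by rwa [← mul_smul, ← pow_succ])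
    obtain ⟨c, hc⟩ := H.exists_zeta_eq h (by rw [← mul_smul, ← pow_succ', h'])
    obtain ⟨k, hk⟩ := H.tors (x - (b : ℤ[X]) • θ) (by linear_combination (norm := module) hb)
    refine ⟨b + k * (c * p ^ (t + 1)), ?_⟩
    push_cast
    linear_combination (norm := module) hk + (k : ℤ[X]) • hc

/-- A torsion element spans a Galois stable cyclic group. -/
theorem exists_X_smul_eq (H : KummerModule p n ζ) {t : ℕ} {θ : A} (h : (p : ℤ[X]) ^ t • θ ≠ 0)
    (h' : (p : ℤ[X]) ^ (t + 1) • θ = 0) :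
    ∃ e : ℤ, (X : ℤ[X]) • θ = (1 + (p : ℤ[X]) * (e : ℤ[X])) • θ := by
  obtain ⟨b, hb⟩ := H.exists_eq_smul_of_torsion h h' (x := (X : ℤ[X]) • θ)
    (by rw [smul_comm, h', smul_zero])
  obtain ⟨c, hc⟩ := H.exists_zeta_eq h (by rw [← mul_smul, ← pow_succ', h'])
  have h1 := mem_lev_zero.1 H.zeta_mem
  obtain ⟨k, hk⟩ : (p : ℤ) ∣ b - 1 := by
    apply H.eq_zero_of_intCast_smul_zeta
    push_cast
    linear_combination (norm := module)
      h1 + ((b : ℤ[X]) - (X : ℤ[X])) • hc - ((c : ℤ[X]) * (p : ℤ[X]) ^ t) • hb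
  refine ⟨k, ?_⟩
  have : b = 1 + p * k := by linarith
  rw [hb, this]
  push_cast
  rfl

end KummerModule

namespace MinTuple

variable {H : KummerModule p n ζ} {s : ℕ} {la : ℕ → ℕ} {I : Set ℕ} {e : ℤ} {α : A} {δ : ℕ → A}

/-- Norms of torsion elements lie in `p A_0`. -/
theorem norm_torsion_mem (T : MinTuple H s la I e α δ)
    {t : ℕ} {θ : A} (h : (p : ℤ[X]) ^ t • θ = 0) :
    relNorm p 0 n • θ ∈ baseRange A p := by
  induction t with
  | zero =>
    rw [pow_zero, one_smul] at h
    rw [h, smul_zero]; exact zero_mem _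
  | succ t ih =>
  by_cases h0 : (p : ℤ[X]) ^ t • θ = 0
  · exact ih h0
  obtain ⟨e', he'⟩ := H.exists_X_smul_eq h0 h
  have h1 := T.min s le_rfl T.last_mem e' θ 0 0 0 (fun j _ => ⟨zero_mem _, fun _ => rfl⟩)
    (Or.inl rfl) (by simp only [Pi.zero_apply, smul_zero, sum_const_zero, add_zero]
                     rw [sub_smul, he', sub_self])
  simp only [Pi.zero_apply, smul_zero, sum_const_zero, add_zero] at h1
  obtain ⟨Y, hY⟩ := exists_eq_eval_add (relNorm p 0 n) (1 + p * e')
  have hN : relNorm p 0 n • θ = (((relNorm p 0 n).eval (1 + p * e') : ℤ) : ℤ[X]) • θ := by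
    nth_rw 1 [hY]
    push_cast
    linear_combination (norm := module) Y • he'
  obtain ⟨k, hk⟩ : (p : ℤ) ∣ (relNorm p 0 n).eval (1 + p * e') := by
    have h2 := (relNorm p 0 n).sub_dvd_eval_sub (1 + p * e') 1
    rw [eval_relNorm_one] at h2
    have h3 := (Dvd.intro e' (by ring) : (p : ℤ) ∣ 1 + p * e' - 1).trans h2
    simpa using dvd_add h3 (dvd_pow_self (p : ℤ) H.pos.ne')
  rw [hk] at hN
  push_cast at hN
  rw [mul_smul] at hN
  rw [hN]
  refine smul_mem_baseRange (mem_lev_zero.2 ?_)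
  rw [hN] at h1
  linear_combination (norm := module) (k : ℤ[X]) • he' + h1

/-- A relation expressing `ζ` as a multiple of `x` modulo `p ^ N` forces `ζ ∈ p ^ N A`. -/
theorem zeta_mem_of_sub_mem (T : MinTuple H s la I e α δ) {N : ℕ} {x : A} {c : ℤ}
    (hx : ∀ u : ℤ, (u : ℤ[X]) • relNorm p 0 n • x ∈ baseRange A p → (p : ℤ) ∣ u)
    (h : ζ - (c : ℤ[X]) • x ∈ mulRange A ((p : ℤ[X]) ^ N)) :
    ζ ∈ mulRange A ((p : ℤ[X]) ^ N) := by
  by_cases hc : (p : ℤ) ^ N ∣ c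
  · obtain ⟨k, rfl⟩ := hc
    have := add_mem h (smul_mem_mulRange ((p : ℤ[X]) ^ N) ((k : ℤ[X]) • x))
    rw [← mul_smul] at this
    push_cast at this
    simpa using this
  exfalso
  have hc0 : c ≠ 0 := by rintro rfl; exact hc (dvd_zero _)
  obtain ⟨v, u, hu, rfl⟩ := exists_eq_pow_mul_not_dvd H.prime hc0
  have hv : v < N := by
    by_contra hv
    exact hc (Dvd.dvd.mul_right (pow_dvd_pow _ (by omega)) _)
  obtain ⟨r, rfl⟩ := Nat.exists_eq_add_of_lt hv
  obtain ⟨y, hy⟩ := mem_mulRange.1 h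
  push_cast at hy
  have hθ : (p : ℤ[X]) ^ v • ((u : ℤ[X]) • x + (p : ℤ[X]) ^ (r + 1) • y) = ζ := by
    linear_combination (norm := module) hy
  have := T.norm_torsion_mem (t := v + 1) (θ := (u : ℤ[X]) • x + (p : ℤ[X]) ^ (r + 1) • y) (by
    rw [pow_succ', mul_smul, hθ, H.zeta_tors])
  refine hu (hx u ?_)
  have h2 : relNorm p 0 n • (p : ℤ[X]) ^ (r + 1) • y ∈ baseRange A p := by
    rw [pow_succ', mul_smul, smul_comm]
    exact smul_mem_baseRange (H.norm_mem _)
  have h3 := sub_mem this h2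
  rw [smul_add, add_sub_cancel_right, smul_comm] at h3
  exact h3

/-- The coefficients in the expression of `ζ` obtained by eliminating `N α`. -/
noncomputable def zetaCoeff (p n : ℕ) (d : ℤ) (Q : ℤ[X]) : ℕ → ℤ[X]
  | 0 => relNorm p 0 (n - 1) - Q
  | j + 1 => (p : ℤ[X]) ^ j * twistNorm p n d

theorem exists_zeta_eq (T : MinTuple H s la I e α δ) : ∃ (W : ℤ) (Q : ℤ[X]),
    (1 + p * e) ^ p ^ n = 1 + p * W ∧
    (p : ℤ[X]) * Q = relNorm p 0 n - twistNorm p n (1 + p * e) ∧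
    ζ = (W : ℤ[X]) • α + ∑ j ∈ range (s + 2), zetaCoeff p n (1 + p * e) Q j • δ j := by
  obtain ⟨Q, hQ⟩ := dvd_relNorm_sub_twistNorm (p := p) (d := 1 + p * e) ⟨e, by ring⟩ n
  obtain ⟨W, hW⟩ : (p : ℤ) ∣ (1 + p * e) ^ p ^ n - 1 :=
    (Dvd.intro e (by ring) : (p : ℤ) ∣ 1 + p * e - 1).trans
      (by simpa using sub_dvd_pow_sub_pow (1 + p * e : ℤ) 1 (p ^ n))
  refine ⟨W, Q, by linarith, hQ.symm, ?_⟩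
  have h1 := relNorm_mul_sub (p := p) 0 n
  simp only [pow_zero, pow_one, zero_add] at h1
  have h2 := twistNorm_mul (p := p) n (1 + p * e)
  have hW' : ((1 + (p : ℤ[X]) * (e : ℤ[X])) ^ p ^ n - 1) = (p : ℤ[X]) * W := by
    exact_mod_cast congrArg (Int.cast (R := ℤ[X])) hW
  push_cast at h2
  have hp0 : (p : ℤ[X]) ≠ 0 := by exact_mod_cast H.prime.ne_zero
  have h3 : Q * (X - (1 + (p : ℤ[X]) * (e : ℤ[X]))) = (W : ℤ[X]) - (e : ℤ[X]) * relNorm p 0 n := by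
    apply mul_left_cancel₀ hp0
    linear_combination -(X - (1 + (p : ℤ[X]) * (e : ℤ[X]))) * hQ + h1 - h2 + hW'
  have h4 : ∑ j ∈ range (s + 2), zetaCoeff p n (1 + p * e) Q j • δ j =
      ∑ j ∈ range (s + 2), psi p n j • δ j -
        Q • ∑ j ∈ range (s + 2), (p : ℤ[X]) ^ j • δ j := by
    rw [smul_sum, ← sum_sub_distrib]
    refine sum_congr rfl fun j _ => ?_
    cases j with
    | zero => simp [zetaCoeff, psi_zero, sub_smul]
    | succ j =>
      rw [zetaCoeff, psi_succ]
      linear_combination (norm := module) -((p : ℤ[X]) ^ j • hQ) • δ (j + 1)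
  rw [h4]
  linear_combination (norm := module) h3 • α - Q • T.eqn - T.chi

theorem _root_.MSS.KummerModule.exists_zetaCoeff_smul (H : KummerModule p n ζ) {d : ℤ} {Q : ℤ[X]}
    (hd : (p : ℤ) ∣ d - 1) (hQ : (p : ℤ[X]) * Q = relNorm p 0 n - twistNorm p n d) {a : ℕ}
    (ha : a < n) :
    ∃ ω : ℤ, (relNorm p a (n - a)).eval d = p * ω ∧ ∀ j, ∀ x ∈ lev A p a,
      zetaCoeff p n d Q j • x = ((p ^ j * ω : ℤ) : ℤ[X]) • twistNorm p a d • x := by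
  obtain ⟨ω, hω⟩ : (p : ℤ) ∣ (relNorm p a (n - a)).eval d := by
    have h2 := (relNorm p a (n - a)).sub_dvd_eval_sub d 1
    rw [eval_relNorm_one] at h2
    simpa using dvd_add (hd.trans h2) (dvd_pow_self (p : ℤ) (show n - a ≠ 0 by omega))
  refine ⟨ω, hω, fun j x hx => ?_⟩
  have h1 := dvd_twistNorm_sub (p := p) d a (n - a)
  rw [Nat.add_sub_cancel' ha.le, hω] at h1
  rw [← mul_smul]
  refine smul_eq_of_dvd_sub hx ?_
  cases j with
  | zero =>
    apply dvd_of_dvd_natCast_mul H.prime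
    have h2 := dvd_relNorm_sub (p := p) (n - 1) 1
    have h3 := relNorm_mul_relNorm H.prime (p := p) 0 (n - 1) 1
    rw [show n - 1 + 1 = n by omega, zero_add] at h3
    have h4 := X_pow_sub_one_dvd (p := p) a (n - 1 - a)
    rw [show a + (n - 1 - a) = n - 1 by omega] at h4
    have h5 := dvd_sub h1 ((h4.trans h2).mul_left (relNorm p 0 (n - 1)))
    refine h5.trans (dvd_of_eq ?_)
    rw [zetaCoeff]
    push_cast
    linear_combination hQ - h3
  | succ j =>
    refine (h1.mul_left ((p : ℤ[X]) ^ j)).trans (dvd_of_eq ?_)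
    rw [zetaCoeff]
    push_cast
    ring

theorem zetaCoeff_smul_mem (T : MinTuple H s la I e α δ) {Q : ℤ[X]}
    (hQ : (p : ℤ[X]) * Q = relNorm p 0 n - twistNorm p n (1 + p * e)) {j : ℕ} (hj : j < s + 2)
    (hgood : j < s → j ∈ I → p = 2 → (2 : ℤ) ∣ e ∨ 1 ≤ la j) :
    zetaCoeff p n (1 + p * e) Q j • δ j ∈ mulRange A ((p : ℤ[X]) ^ (s - 1)) := by
  rcases lt_or_ge j s with hjs | hjs
  · by_cases hI : j ∈ I
    · have ha := T.la_lt_top hjs hI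
      obtain ⟨ω, hω, hω'⟩ := H.exists_zetaCoeff_smul ⟨e, by ring⟩ hQ ha
      obtain ⟨u, hu, -⟩ := exists_geom_sum_eq_mul H.prime (d := 1 + p * e) ⟨e, by ring⟩ (la j) (by
        rintro rfl
        refine (hgood hjs hI rfl).imp (fun ⟨k, hk⟩ => ⟨k, ?_⟩) id
        rw [hk]; push_cast; ring) (n - la j)
      have hle := T.le_of_good hjs hI (hgood hjs hI)
      obtain ⟨r, hr⟩ : ∃ r, n - la j = r + 1 := ⟨n - la j - 1, by omega⟩
      have hωu : ω = p ^ r * u := by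
        have hp0 : (p : ℤ) ≠ 0 := by exact_mod_cast H.prime.ne_zero
        apply mul_left_cancel₀ hp0
        rw [← hω, hu, hr]; ring
      rw [hω' j _ (T.mem j hjs.le)]
      refine mulRange_mono ?_ (smul_mem_mulRange _ _)
      rw [hωu, ← mul_assoc, ← pow_add]
      push_cast
      exact Dvd.dvd.mul_right (pow_dvd_pow _ (by omega)) _
    · rw [T.zero j hjs.le hI, smul_zero]; exact zero_mem _
  · have hs := T.pos
    obtain ⟨k, rfl⟩ : ∃ k, j = k + 1 := ⟨j - 1, by omega⟩
    refine mulRange_mono ?_ (smul_mem_mulRange _ _)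
    rw [zetaCoeff]
    exact Dvd.dvd.mul_right (pow_dvd_pow _ (by omega)) _

theorem zeta_not_mem_baseRange (T : MinTuple H s la I e α δ)
    (hs : 2 ≤ s) (he : ¬ (p : ℤ) ∣ e) : ζ ∉ baseRange A p := by
  intro h
  apply he
  have h1 : ∑ j ∈ range (s + 2), psi p n j • δ j ∈ baseRange A p := by
    refine sum_mem fun j hj => ?_
    match j with
    | 0 =>
      obtain ⟨η, hη, h⟩ := T.exists_norm_pred
      rw [psi_zero, h]
      exact smul_mem_baseRange hη
    | 1 =>
      rw [psi_succ, pow_zero, one_mul]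
      by_cases hI : 1 ∈ I
      · exact T.norm_smul_mem_baseRange (by omega) (T.la_lt_top (by omega) hI)
      · rw [T.zero 1 (by omega) hI, smul_zero]; exact zero_mem _
    | j + 2 =>
      rw [psi_succ, pow_succ', mul_assoc, mul_smul, mul_smul]
      exact smul_mem_baseRange (Submodule.smul_mem _ _ (H.norm_mem _))
  rw [← T.chi] at h
  obtain ⟨f, hf, hf'⟩ := mem_baseRange.1 ((Submodule.add_mem_iff_left _ h1).1 h)
  exact T.root.dvd hf hf'.symm

end MinTuple

end Torsion

end MSS

namespace MSS

open Polynomial Finset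

section ZetaPower

variable {A : Type*} [AddCommGroup A] [Module ℤ[X] A] {p n : ℕ} {ζ : A}

namespace MinTuple

variable {H : KummerModule p n ζ} {s : ℕ} {la : ℕ → ℕ} {I : Set ℕ} {e : ℤ} {α : A} {δ : ℕ → A}

theorem dvd_of_smul_norm_mem (T : MinTuple H s la I e α δ) {u : ℤ}
    (h : (u : ℤ[X]) • relNorm p 0 n • α ∈ baseRange A p) : (p : ℤ) ∣ u := by
  obtain ⟨f, hf, hf'⟩ := mem_baseRange.1 h
  exact T.root.dvd hf hf'.symm

theorem zeta_mem_of_good (T : MinTuple H s la I e α δ)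
    (hgood : ∀ j < s, j ∈ I → p = 2 → (2 : ℤ) ∣ e ∨ 1 ≤ la j) :
    ζ ∈ mulRange A ((p : ℤ[X]) ^ (s - 1)) := by
  obtain ⟨W, Q, -, hQ, hζ⟩ := T.exists_zeta_eq
  refine T.zeta_mem_of_sub_mem (x := α) (c := W) (fun u hu => T.dvd_of_smul_norm_mem hu) ?_
  nth_rw 1 [hζ]
  rw [add_sub_cancel_left]
  exact sum_mem fun j hj => T.zetaCoeff_smul_mem hQ (mem_range.1 hj) (hgood j)

theorem exists_zeta_sub_mem (T : MinTuple H s la I e α δ)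
    {i : ℕ} (hi : i < s) (hI : i ∈ I) (hla : la i = 0) :
    ∃ ω : ℤ, (relNorm p 0 n).eval (1 + p * e) = p * ω ∧
      ζ - (ω : ℤ[X]) • ((p : ℤ[X]) • (e : ℤ[X]) • α + (p : ℤ[X]) ^ i • δ i) ∈
        mulRange A ((p : ℤ[X]) ^ (s - 1)) := by
  obtain ⟨W, Q, hW, hQ, hζ⟩ := T.exists_zeta_eq
  obtain ⟨ω, hω, hω'⟩ := H.exists_zetaCoeff_smul ⟨e, by ring⟩ hQ (T.la_lt_top hi hI)
  rw [hla, Nat.sub_zero] at hω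
  refine ⟨ω, hω, ?_⟩
  have hp0 : (p : ℤ) ≠ 0 := by exact_mod_cast H.prime.ne_zero
  have h1 := congrArg (Polynomial.eval (1 + p * e)) (relNorm_mul_sub (p := p) 0 n)
  simp only [pow_zero, pow_one, zero_add, eval_mul, eval_sub, eval_X, eval_one, eval_pow] at h1
  have hWω : W = p * e * ω := by
    apply mul_left_cancel₀ hp0
    rw [hω] at h1
    linarith
  have h2 := hω' i (δ i) (T.mem i hi.le)
  rw [hla, twistNorm_zero, one_smul] at h2
  rw [← add_sum_erase _ _ (mem_range.2 (by omega : i < s + 2)), h2, hWω] at hζ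
  have h3 : ∑ j ∈ (range (s + 2)).erase i, zetaCoeff p n (1 + p * e) Q j • δ j ∈
      mulRange A ((p : ℤ[X]) ^ (s - 1)) := by
    refine sum_mem fun j hj => ?_
    obtain ⟨hji, hj⟩ := mem_erase.1 hj
    refine T.zetaCoeff_smul_mem hQ (mem_range.1 hj) fun hjs hjI _ => Or.inr ?_
    rcases lt_or_gt_of_ne hji with h | h
    · have := T.la_lt h hi.le hjI hI
      omega
    · have := T.la_lt h hjs.le hI hjI
      omega
  convert h3 using 1
  push_cast at hζ
  linear_combination (norm := module) hζ

theorem zeta_mem_of_pos (T : MinTuple H s la I e α δ)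
    {i : ℕ} (h0 : 1 ≤ i) (hi : i < s) (hI : i ∈ I) (hla : la i = 0)
    (he : ¬ (p : ℤ) ∣ e) : ζ ∈ mulRange A ((p : ℤ[X]) ^ (s - 1)) := by
  obtain ⟨ω, -, hω⟩ := T.exists_zeta_sub_mem hi hI hla
  obtain ⟨i, rfl⟩ := Nat.exists_eq_add_of_le' h0
  refine T.zeta_mem_of_sub_mem (x := (e : ℤ[X]) • α + (p : ℤ[X]) ^ i • δ (i + 1)) (c := p * ω)
    (fun u hu => ?_) ?_
  · refine ((Nat.prime_iff_prime_int.1 H.prime).dvd_or_dvd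
      (T.dvd_of_smul_norm_mem (u := u * e) ?_)).resolve_right he
    have h1 := Submodule.smul_mem _ ((u : ℤ[X]) * (p : ℤ[X]) ^ i)
      (T.norm_smul_mem_baseRange hi.le (T.la_lt_top hi hI))
    convert sub_mem hu h1 using 1
    push_cast
    module
  · convert hω using 1
    push_cast
    module

theorem zeta_mem_of_zero (T : MinTuple H s la I e α δ)
    (h0 : 0 ∈ I) (hla : la 0 = 0) (he : ¬ (p : ℤ) ∣ e)
    (hpp : (p : ℤ) * p ∣ (relNorm p 0 n).eval (1 + p * e)) :
    ζ ∈ mulRange A ((p : ℤ[X]) ^ (s - 1)) := by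
  have hprime := Nat.prime_iff_prime_int.1 H.prime
  have hp0 : (p : ℤ) ≠ 0 := hprime.ne_zero
  obtain ⟨ω, hω, h⟩ := T.exists_zeta_sub_mem T.pos h0 hla
  simp only [pow_zero, one_smul] at h
  by_cases hdvd : (p : ℤ) ^ (s - 1) ∣ ω
  · obtain ⟨k, rfl⟩ := hdvd
    have := add_mem h (smul_mem_mulRange ((p : ℤ[X]) ^ (s - 1))
      ((k : ℤ[X]) • ((p : ℤ[X]) • (e : ℤ[X]) • α + δ 0)))
    convert this using 1
    push_cast
    module
  exfalso
  have hω0 : ω ≠ 0 := by rintro rfl; exact hdvd (dvd_zero _)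
  obtain ⟨v, u, hu, rfl⟩ := exists_eq_pow_mul_not_dvd H.prime hω0
  have hv : v < s - 1 := by
    by_contra hv
    exact hdvd (Dvd.dvd.mul_right (pow_dvd_pow _ (by omega)) _)
  obtain ⟨v, rfl⟩ : ∃ k, v = k + 1 := by
    refine Nat.exists_eq_succ_of_ne_zero ?_
    rintro rfl
    rw [hω, pow_zero, one_mul] at hpp
    exact hu (Int.dvd_of_mul_dvd_mul_left hp0 hpp)
  obtain ⟨r, hr⟩ := Nat.exists_eq_add_of_lt hv
  rw [hr] at h
  obtain ⟨y₁, hy₁⟩ := mem_mulRange.1 h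
  push_cast at hy₁
  obtain ⟨θ, hθ⟩ : ∃ θ : A, θ = (u : ℤ[X]) • ((p : ℤ[X]) • (e : ℤ[X]) • α + δ 0) +
    (p : ℤ[X]) ^ (r + 1) • y₁ := ⟨_, rfl⟩
  have hθζ : (p : ℤ[X]) ^ (v + 1) • θ = ζ := by
    rw [hθ]
    linear_combination (norm := module) hy₁
  obtain ⟨eθ, heθ⟩ := H.exists_X_smul_eq (t := v + 1) (θ := θ) (by rw [hθζ]; exact H.zeta_ne)
    (by rw [pow_succ', mul_smul, hθζ, H.zeta_tors])
  have heθ' : ¬ (p : ℤ) ∣ eθ := by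
    rintro ⟨k, rfl⟩
    refine T.zeta_not_mem_baseRange (by omega) he ?_
    rw [← hθζ, pow_succ', mul_smul]
    refine smul_mem_baseRange (mem_lev_zero.2 ?_)
    have hz := H.zeta_tors
    rw [← hθζ] at hz
    push_cast at heθ
    linear_combination (norm := module) (p : ℤ[X]) ^ v • heθ + (k : ℤ[X]) • hz
  obtain ⟨y, hy⟩ : ∃ y : A, y = -((u : ℤ[X]) • (e : ℤ[X]) • α + (p : ℤ[X]) ^ r • y₁) := ⟨_, rfl⟩
  have huy : (u : ℤ[X]) • δ 0 = θ + (p : ℤ[X]) • y := by rw [hθ, hy]; module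
  have hδ0 : δ 0 ∈ lev A p 0 := by simpa [hla] using T.mem 0 (Nat.zero_le _)
  obtain ⟨c, hc⟩ := H.tors ((eθ : ℤ[X]) • θ + (X - 1 : ℤ[X]) • y) (by
    linear_combination (norm := module)
      -((X - 1 : ℤ[X]) • huy) + (u : ℤ[X]) • mem_lev_zero.1 hδ0 - heθ)
  obtain ⟨e₁, he₁⟩ : ∃ e₁ : ℤ, e₁ = eθ - c * p ^ (v + 1) := ⟨_, rfl⟩
  have he₁' : ¬ (p : ℤ) ∣ e₁ := fun h' => heθ' (by
    rw [show eθ = e₁ + c * p ^ (v + 1) by rw [he₁]; ring]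
    exact dvd_add h' (Dvd.dvd.mul_left (dvd_pow_self _ (by omega)) _))
  have he₁c : (e₁ : ℤ[X]) = eθ - c * p ^ (v + 1) := by rw [he₁]; push_cast; rfl
  have hy' : (X - (1 + (p : ℤ[X]) * (e₁ : ℤ[X]))) • y = -((e₁ : ℤ[X]) • (u : ℤ[X]) • δ 0) := by
    rw [← hθζ] at hc
    linear_combination (norm := module) hc + he₁c • θ + (e₁ : ℤ[X]) • huy
  have h1 := T.min s le_rfl T.last_mem e₁ y
    (fun j => if j = 0 then -((e₁ : ℤ[X]) • (u : ℤ[X]) • δ 0) else 0) 0 0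
    (fun j _ => by
      split_ifs with hj
      · subst hj
        rw [hla]
        exact ⟨neg_mem (Submodule.smul_mem _ _ (Submodule.smul_mem _ _ hδ0)),
          fun hj => absurd h0 hj⟩
      · exact ⟨zero_mem _, fun _ => rfl⟩) (Or.inl rfl)
    (by rw [sum_smul_single _ T.pos, hy']; module)
  rw [sum_smul_single _ T.pos] at h1
  obtain ⟨β, hβ, hβ'⟩ := exists_sum_eq_add (p := p) (n := n) δ (show 0 < s + 2 by omega)
  have hE := T.eqn
  have hχ := T.chi
  rw [hβ] at hE
  rw [hβ'] at hχ
  have h2 := T.min 0 (Nat.zero_le _) h0 e ((e₁ : ℤ[X]) • (u : ℤ[X]) • α + y) (fun _ => 0) 0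
    ((e₁ : ℤ[X]) • (u : ℤ[X]) • β + ((e₁ : ℤ[X]) - (e : ℤ[X])) • y) (by simp) (Or.inl rfl) (by
      simp only [range_zero, sum_empty] at hE ⊢
      linear_combination (norm := module) ((e₁ : ℤ[X]) * u) • hE + hy')
  simp only [range_zero, sum_empty, zero_add, psi_succ, pow_zero, one_mul] at h1 h2 hχ
  have h3 := H.eq_zero_of_intCast_smul_zeta (c := e₁ * u) (by
    push_cast
    linear_combination (norm := module) h2 - ((e₁ : ℤ[X]) * u) • hχ - h1)
  exact (hprime.dvd_or_dvd h3).elim he₁' hu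

theorem zeta_mem (T : MinTuple H s la I e α δ) : ζ ∈ mulRange A ((p : ℤ[X]) ^ (s - 1)) := by
  by_cases hgood : ∀ j < s, j ∈ I → p = 2 → (2 : ℤ) ∣ e ∨ 1 ≤ la j
  · exact T.zeta_mem_of_good hgood
  push Not at hgood
  obtain ⟨i, hi, hI, hp2, he, hla⟩ := hgood
  rw [Nat.lt_one_iff] at hla
  have he' : ¬ (p : ℤ) ∣ e := by rw [hp2]; exact_mod_cast he
  rcases Nat.eq_zero_or_pos i with rfl | h0
  · refine T.zeta_mem_of_zero hI hla he' ?_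
    have h1 := relNorm_mul_relNorm H.prime (p := p) 0 1 (n - 1)
    rw [Nat.add_sub_cancel' H.pos] at h1
    rw [← h1, eval_mul]
    refine Dvd.dvd.mul_right ?_ _
    obtain ⟨k, rfl⟩ := Int.not_even_iff_odd.1 (fun h => he h.two_dvd)
    rw [eval_relNorm, hp2]
    simp only [pow_zero, pow_one, sum_range_succ, range_zero, sum_empty]
    exact ⟨k + 1, by push_cast; ring⟩
  · exact T.zeta_mem_of_pos h0 hi hI hla he'

end MinTuple

end ZetaPower

end MSS

namespace MSS

open Polynomial Finset

section Independence

variable {A : Type*} [AddCommGroup A] [Module ℤ[X] A] {p n : ℕ} {ζ : A}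

namespace MinTuple

variable {H : KummerModule p n ζ} {s : ℕ} {la : ℕ → ℕ} {I : Set ℕ} {e : ℤ} {α : A} {δ : ℕ → A}

theorem exists_smul_last_eq (T : MinTuple H s la I e α δ)
    {q : ℕ} (hq : q ≤ s) {c : ℤ} {g : ℕ → ℤ[X]} {τ : A}
    (hτ : (p : ℤ[X]) ^ (s - q) • τ = 0)
    (h : (c : ℤ[X]) • α + ∑ j ∈ range (s + 1), g j • δ j + τ ∈ mulRange A ((p : ℤ[X]) ^ q)) :
    ∃ h' : ℤ[X], g s • δ s = (p : ℤ[X]) ^ q • h' • δ s := by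
  induction q generalizing c g τ with
  | zero => exact ⟨g s, by rw [pow_zero, one_smul]⟩
  | succ q ih =>
    obtain ⟨y, hy⟩ := mem_mulRange.1 h
    have hτp : τ ∈ mulRange A (p : ℤ[X]) := by
      refine H.mem_mulRange_of_pow_smul_eq_zero T.zeta_mem ?_
      obtain ⟨k, hk⟩ : ∃ k, s - 1 = k + (s - (q + 1)) := ⟨q, by omega⟩
      rw [hk, pow_add, mul_smul, hτ, smul_zero]
    have h1 : (c : ℤ[X]) • α + ∑ j ∈ range (s + 1), g j • δ j ∈ mulRange A (p : ℤ[X]) := by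
      rw [← Submodule.add_mem_iff_left _ hτp]
      exact mulRange_mono (dvd_pow_self _ q.succ_ne_zero) h
    obtain ⟨c, rfl⟩ := T.norm_sum_mem h1
    have h2 : ∑ j ∈ range (s + 1), g j • δ j ∈ mulRange A (p : ℤ[X]) := by
      refine (Submodule.add_mem_iff_right _ ?_).1 h1
      push_cast
      rw [mul_smul]
      exact smul_mem_mulRange _ _
    have h3 : ∀ j, ∃ u : ℤ[X], j ≤ s → g j • δ j = (p : ℤ[X]) • u • δ j := fun j => by
      by_cases hj : j ≤ s
      · by_cases hI : j ∈ I
        · obtain ⟨u, hu⟩ := exists_smul_eq_of_mem_levIdeal (A := A)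
            (T.mem_levIdeal_of_sum_mem h2 hj hI)
          exact ⟨u, fun _ => hu _ (T.mem j hj)⟩
        · exact ⟨0, fun _ => by simp [T.zero j hj hI]⟩
      · exact ⟨0, fun h => absurd h hj⟩
    choose u hu using h3
    have h4 : ∑ j ∈ range (s + 1), g j • δ j =
        (p : ℤ[X]) • ∑ j ∈ range (s + 1), u j • δ j := by
      rw [smul_sum]
      exact sum_congr rfl fun j hj => hu j (by simpa [Nat.lt_succ_iff] using hj)
    rw [h4] at hy
    push_cast at hy
    obtain ⟨h', hh'⟩ := ih (by omega) (c := c) (g := u)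
      (τ := (p : ℤ[X]) ^ q • y - ((c : ℤ[X]) • α + ∑ j ∈ range (s + 1), u j • δ j)) (by
        rw [show s - q = s - (q + 1) + 1 by omega]
        linear_combination (norm := module)
          (p : ℤ[X]) ^ (s - (q + 1)) • hy + hτ) (by
        rw [add_sub_cancel]
        exact smul_mem_mulRange _ _)
    exact ⟨h', by rw [hu s le_rfl, hh']; module⟩

/-- The submodules spanned by `α, δ 0, …, δ (s - 1)` and by `δ s` are independent modulo `p ^ s`. -/
theorem smul_last_mem (T : MinTuple H s la I e α δ) {f h : ℤ[X]} {g : ℕ → ℤ[X]}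
    (hmem : f • α + ∑ j ∈ range s, g j • δ j - h • δ s ∈ mulRange A ((p : ℤ[X]) ^ s)) :
    h • δ s ∈ mulRange A ((p : ℤ[X]) ^ s) := by
  obtain ⟨f', hf'⟩ := exists_eq_eval_add f (1 + p * e)
  have h1 := T.eqn
  rw [sum_range_succ, sum_range_succ] at h1
  obtain ⟨h', hh'⟩ := T.exists_smul_last_eq le_rfl (c := f.eval (1 + p * e)) (τ := 0)
    (g := fun j => if j = s then (p : ℤ[X]) ^ s * f' - h else (p : ℤ[X]) ^ j * f' + g j)
    (smul_zero _) (by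
      have h2 : ∑ j ∈ range s, (if j = s then (p : ℤ[X]) ^ s * f' - h
          else (p : ℤ[X]) ^ j * f' + g j) • δ j =
          f' • ∑ j ∈ range s, (p : ℤ[X]) ^ j • δ j + ∑ j ∈ range s, g j • δ j := by
        rw [smul_sum, ← sum_add_distrib]
        refine sum_congr rfl fun j hj => ?_
        rw [if_neg (mem_range.1 hj).ne]
        module
      rw [sum_range_succ, if_pos rfl, h2, add_zero]
      convert sub_mem hmem (smul_mem_mulRange ((p : ℤ[X]) ^ s)
        ((p : ℤ[X]) • f' • δ (s + 1))) using 1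
      push_cast at hf'
      linear_combination (norm := module) -(hf' • α) - f' • h1)
  rw [if_pos rfl] at hh'
  refine mem_mulRange.2 ⟨f' • δ s - h' • δ s, ?_⟩
  linear_combination (norm := module) hh'

end MinTuple

end Independence

end MSS

namespace MSS

open Polynomial Finset

section UnitModule

variable {F K : Type*} [Field F] [Field K] [Algebra F K]

theorem umap_mul (σ τ : K ≃ₐ[F] K) (x : Kˣ) : umap (σ * τ) x = umap σ (umap τ x) := rfl

theorem umap_one (x : Kˣ) : umap (1 : K ≃ₐ[F] K) x = x := rfl

theorem coe_umap (σ : K ≃ₐ[F] K) (x : Kˣ) : (umap σ x : K) = σ x := rfl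

/-- The multiplicative group of `K` as a `ℤ[X]`-module, with `X` acting as `σ`. -/
abbrev UnitModule (σ : K ≃ₐ[F] K) : Type _ :=
  Module.AEval' (MonoidHom.toAdditive (umap σ)).toIntLinearMap

/-- A unit of `K` as an element of the module `UnitModule σ`. -/
noncomputable def toModule (σ : K ≃ₐ[F] K) (x : Kˣ) : UnitModule σ :=
  Module.AEval'.of _ (Additive.ofMul x)

variable (σ : K ≃ₐ[F] K)

theorem toModule_injective : Function.Injective (toModule σ) :=
  fun _ _ h => Additive.ofMul.injective ((Module.AEval'.of _).injective h)

theorem toModule_surjective : Function.Surjective (toModule σ) := fun y =>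
  ⟨((Module.AEval'.of _).symm y).toMul, by simp [toModule]⟩

theorem toModule_mul (x y : Kˣ) : toModule σ (x * y) = toModule σ x + toModule σ y := by
  simp [toModule]

theorem toModule_one : toModule σ 1 = 0 := by simp [toModule]

theorem toModule_eq_zero {x : Kˣ} : toModule σ x = 0 ↔ x = 1 := by
  rw [← toModule_one σ, (toModule_injective σ).eq_iff]

theorem toModule_inv (x : Kˣ) : toModule σ x⁻¹ = -toModule σ x := by
  rw [eq_neg_iff_add_eq_zero, ← toModule_mul, inv_mul_cancel, toModule_one]

theorem toModule_zpow (x : Kˣ) (c : ℤ) : toModule σ (x ^ c) = (c : ℤ[X]) • toModule σ x := by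
  rw [Int.cast_smul_eq_zsmul]
  simp [toModule]

theorem toModule_pow (x : Kˣ) (c : ℕ) : toModule σ (x ^ c) = (c : ℤ[X]) • toModule σ x := by
  rw [← zpow_natCast, toModule_zpow, Int.cast_natCast]

theorem toModule_pow_pow (x : Kˣ) (p c : ℕ) :
    toModule σ (x ^ p ^ c) = (p : ℤ[X]) ^ c • toModule σ x := by
  rw [toModule_pow, Nat.cast_pow]

theorem toModule_prod {ι : Type*} (t : Finset ι) (f : ι → Kˣ) :
    toModule σ (∏ i ∈ t, f i) = ∑ i ∈ t, toModule σ (f i) := by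
  classical
  induction t using Finset.induction_on with
  | empty => simp [toModule_one]
  | insert i t hi ih => rw [prod_insert hi, sum_insert hi, toModule_mul, ih]

theorem toModule_umap (x : Kˣ) : toModule σ (umap σ x) = (X : ℤ[X]) • toModule σ x :=
  (Module.AEval'.X_smul_of _ _).symm

theorem toModule_umap_pow (k : ℕ) (x : Kˣ) :
    toModule σ (umap (σ ^ k) x) = (X : ℤ[X]) ^ k • toModule σ x := by
  induction k generalizing x with
  | zero => rw [pow_zero, pow_zero, one_smul, umap_one]
  | succ k ih => rw [pow_succ, umap_mul, ih, toModule_umap, pow_succ, mul_smul]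

theorem toModule_prod_umap (p a c : ℕ) (x : Kˣ) :
    toModule σ (∏ t ∈ range (p ^ c), umap ((σ ^ p ^ a) ^ t) x) =
      relNorm p a c • toModule σ x := by
  simp only [toModule_prod, relNorm, sum_smul, ← pow_mul, toModule_umap_pow]

theorem toModule_normHom (p j : ℕ) (x : Kˣ) :
    toModule σ (normHom p σ j x) = relNorm p 0 j • toModule σ x := by
  rw [← toModule_prod_umap, normHom, MonoidHom.finsetProd_apply]
  simp

theorem toModule_mem_lev {p i : ℕ} {x : Kˣ} :
    toModule σ x ∈ lev (UnitModule σ) p i ↔ x ∈ KiU p σ i := by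
  rw [mem_lev, KiU, MonoidHom.mem_ker, MonoidHom.div_apply, MonoidHom.id_apply, div_eq_one,
    sub_smul, one_smul, ← toModule_umap_pow, sub_eq_zero, (toModule_injective σ).eq_iff]

theorem toModule_mem_mulRange {p r : ℕ} {x : Kˣ} :
    toModule σ x ∈ mulRange (UnitModule σ) ((p : ℤ[X]) ^ r) ↔ x ∈ powSub K (p ^ r) := by
  rw [mem_mulRange, (toModule_surjective σ).exists]
  simp only [← toModule_pow_pow, (toModule_injective σ).eq_iff]
  rfl

theorem exists_eq_div_of_prod_eq_one {τ : K ≃ₐ[F] K} {M : ℕ} (hM : orderOf τ = M) (h0 : 0 < M)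
    {x : Kˣ} (hx : ∏ t ∈ range M, umap (τ ^ t) x = 1) : ∃ y : Kˣ, x = umap τ y / y := by
  have hind : LinearIndependent K fun t : Fin M => ((τ ^ (t : ℕ) : K ≃ₐ[F] K) : K → K) := by
    refine (linearIndependent_monoidHom K K).comp
      (fun t : Fin M => ((τ ^ (t : ℕ) : K ≃ₐ[F] K) : K →* K)) fun s t hst => Fin.ext ?_
    have h1 : (τ ^ (s : ℕ) : K ≃ₐ[F] K) = τ ^ (t : ℕ) :=
      AlgEquiv.ext fun z => DFunLike.congr_fun hst z
    exact pow_injOn_Iio_orderOf (by simp [hM]) (by simp [hM]) h1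
  obtain ⟨P, hP⟩ : ∃ P : ℕ → Kˣ, ∀ t, P t = ∏ s ∈ range t, umap (τ ^ s) x := ⟨_, fun _ => rfl⟩
  have hP1 (t : ℕ) : (x : K) * τ (P t) = P (t + 1) := by
    rw [hP, hP, ← coe_umap, ← Units.val_mul, map_prod, prod_range_succ', mul_comm]
    simp only [← umap_mul, ← pow_succ', pow_zero, umap_one]
  obtain ⟨z, hz⟩ : ∃ z : K, ∑ t ∈ range M, (P t : K) * (τ ^ t) z ≠ 0 := by
    by_contra! hcon
    have := Fintype.linearIndependent_iff.1 hind (fun t => (P t : K)) (by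
      ext z
      rw [Finset.sum_apply]
      simpa [Finset.sum_range] using hcon z) ⟨0, h0⟩
    exact (P 0).ne_zero this
  refine ⟨(Units.mk0 _ hz)⁻¹, ?_⟩
  rw [map_inv, div_inv_eq_mul, eq_inv_mul_iff_mul_eq, mul_comm]
  ext
  rw [Units.val_mul, coe_umap, Units.val_mk0, map_sum, mul_sum]
  have h2 : ∀ t ∈ range M, (x : K) * τ ((P t : K) * (τ ^ t) z) =
      (P (t + 1) : K) * (τ ^ (t + 1)) z := fun t _ => by
    rw [map_mul, ← mul_assoc, hP1, pow_succ', AlgEquiv.mul_apply]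
  rw [sum_congr rfl h2]
  apply add_right_cancel (b := (P 0 : K) * (τ ^ 0) z)
  rw [← sum_range_succ' (fun t => (P t : K) * (τ ^ t) z), sum_range_succ]
  congr 2
  · rw [hP, hP, hx, range_zero, prod_empty]
  · rw [← hM, pow_orderOf_eq_one, pow_zero]

theorem kummerModule {p n : ℕ} (hp : p.Prime) (hn : 0 < n) (horder : orderOf σ = p ^ n) {ξ : Kˣ}
    (hξ : IsPrimitiveRoot (ξ : K) p) (hξF : (ξ : K) ∈ Set.range (algebraMap F K)) :
    KummerModule p n (toModule σ ξ) where
  prime := hp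
  pos := hn
  mem_top x := by
    obtain ⟨x, rfl⟩ := toModule_surjective σ x
    rw [mem_lev, sub_smul, one_smul, ← toModule_umap_pow, ← horder, pow_orderOf_eq_one, umap_one,
      sub_self]
  zeta_tors := by
    rw [← toModule_pow, toModule_eq_zero]
    ext
    simpa using hξ.pow_eq_one
  zeta_ne := by
    rw [Ne, toModule_eq_zero]
    rintro rfl
    exact hp.ne_one (hξ.unique (by simp))
  zeta_mem := by
    obtain ⟨f, hf⟩ := hξF
    rw [mem_lev_zero, sub_smul, one_smul, ← toModule_umap, sub_eq_zero]
    congr 1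
    ext
    rw [coe_umap, ← hf, AlgEquiv.commutes]
  tors x hx := by
    obtain ⟨x, rfl⟩ := toModule_surjective σ x
    rw [← toModule_pow, toModule_eq_zero] at hx
    have : NeZero p := ⟨hp.ne_zero⟩
    obtain ⟨i, -, hi⟩ := hξ.eq_pow_of_pow_eq_one (ξ := (x : K))
      (by rw [← Units.val_pow_eq_pow_val, hx]; rfl)
    refine ⟨i, ?_⟩
    rw [Int.cast_natCast, ← toModule_pow]
    congr 1
    ext
    simp [hi]
  h90 c hc x hx := by
    obtain ⟨x, rfl⟩ := toModule_surjective σ x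
    rw [← toModule_prod_umap, toModule_eq_zero] at hx
    obtain ⟨y, hy⟩ := exists_eq_div_of_prod_eq_one (τ := σ ^ p ^ c) (by
      rw [orderOf_pow_of_dvd (pow_pos hp.pos _).ne' (by rw [horder]; exact pow_dvd_pow p hc),
        horder, Nat.pow_div hc hp.pos]) (pow_pos hp.pos _) hx
    refine ⟨toModule σ y, ?_⟩
    rw [hy, div_eq_mul_inv, toModule_mul, toModule_inv, toModule_umap_pow, sub_smul, one_smul,
      sub_eq_add_neg]

end UnitModule

end MSS

namespace MSS

open Polynomial Finset

section Concrete

variable {F K : Type*} [Field F] [Field K] [Algebra F K]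

theorem levelMem_iff {p : ℕ} {σ : K ≃ₐ[F] K} {a : WithBot ℕ} {γ : Kˣ} :
    levelMem p σ a γ ↔ (a = ⊥ → toModule σ γ = 0) ∧
      ∀ i : ℕ, a = i → toModule σ γ ∈ lev (UnitModule σ) p i := by
  induction a with
  | bot => simp [levelMem, toModule_eq_zero]
  | coe a =>
    simp only [WithBot.coe_ne_bot, false_imp_iff, true_and, toModule_mem_lev]
    refine ⟨fun h i hi => ?_, fun h => h a rfl⟩
    obtain rfl : a = i := WithBot.coe_injective hi
    exact h

theorem represents_iff {p n m : ℕ} (hp : p.Prime) {σ : K ≃ₐ[F] K} {ξ : Kˣ}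
    {a : Fin m → WithBot ℕ} {e : ℤ} {α : Kˣ} {δ : ℕ → Kˣ} :
    Represents p n σ ξ a (1 + p * e) α δ ↔ (∀ i : Fin m, levelMem p σ (a i) (δ i)) ∧
      (X - (1 + (p : ℤ[X]) * (e : ℤ[X]))) • toModule σ α =
        ∑ j ∈ range (m + 1), (p : ℤ[X]) ^ j • toModule σ (δ j) ∧
      (e : ℤ[X]) • relNorm p 0 n • toModule σ α +
        ∑ j ∈ range (m + 1), psi p n j • toModule σ (δ j) = toModule σ ξ := by
  have he : (1 + (p : ℤ) * e - 1) / p = e := by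
    rw [add_sub_cancel_left, Int.mul_ediv_cancel_left _ (by exact_mod_cast hp.ne_zero)]
  have h1 : ∏ i ∈ Icc 1 m, normHom p σ n (δ i) ^ p ^ (i - 1) =
      ∏ i ∈ range m, normHom p σ n (δ (i + 1)) ^ p ^ i := by
    rw [← Ico_succ_right_eq_Icc, prod_Ico_eq_prod_range]
    simp [add_comm]
  rw [Represents, he, h1]
  refine and_congr_right fun _ => and_congr ?_ ?_
  · rw [← (toModule_injective σ).eq_iff, toModule_umap, toModule_mul, toModule_zpow, toModule_prod,
      sub_smul, sub_eq_iff_eq_add']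
    simp only [toModule_pow_pow]
    push_cast
    rfl
  · rw [← (toModule_injective σ).eq_iff, toModule_mul, toModule_mul, toModule_zpow, toModule_prod,
      toModule_normHom, toModule_normHom, sum_range_succ', eq_comm, add_assoc, psi_zero,
      add_comm (relNorm p 0 (n - 1) • _)]
    simp only [toModule_pow_pow, toModule_normHom, psi_succ, mul_smul]

theorem not_pairLE_of_lt {p m : ℕ} {a a' : Fin m → WithBot ℕ} {d d' : ℤ} (i : Fin m)
    (h : ∀ j < i, a' j = a j) (hi : a' i < a i) : ¬ pairLE p a d a' d' := by
  rintro (⟨k, hk, hk'⟩ | ⟨rfl, -⟩)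
  · rcases lt_trichotomy k i with hki | rfl | hki
    · exact hk'.ne (h k hki).symm
    · exact hk'.not_gt hi
    · exact hi.ne (hk i hki).symm
  · exact hi.false

/-- Norm data `χ` attached to a solution of the defining equation is killed by `p`. -/
theorem KummerModule.smul_chi_eq_zero {A : Type*} [AddCommGroup A] [Module ℤ[X] A] {p n : ℕ}
    {ζ : A} (H : KummerModule p n ζ) {N : ℕ} {e : ℤ} {α : A} {δ : ℕ → A}
    (h0 : δ 0 ∈ lev A p (n - 1))
    (h : (X - (1 + (p : ℤ[X]) * (e : ℤ[X]))) • α = ∑ j ∈ range N, (p : ℤ[X]) ^ j • δ j) :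
    (p : ℤ[X]) • ((e : ℤ[X]) • relNorm p 0 n • α + ∑ j ∈ range N, psi p n j • δ j) = 0 := by
  have h1 : (p : ℤ[X]) • ∑ j ∈ range N, psi p n j • δ j =
      relNorm p 0 n • ∑ j ∈ range N, (p : ℤ[X]) ^ j • δ j := by
    rw [smul_sum, smul_sum]
    refine sum_congr rfl fun j _ => ?_
    cases j with
    | zero =>
      rw [H.norm_smul, H.norm_lev (Nat.sub_le n 1) h0, Nat.sub_sub_self H.pos, psi_zero]
      simp
    | succ j => rw [psi_succ]; module
  rw [smul_add, h1, ← h, H.norm_smul]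
  simp only [eval_sub, eval_X, eval_add, eval_one, eval_mul, eval_natCast, eval_intCast, Int.cast_id]
  push_cast
  module

variable {σ : K ≃ₐ[F] K} {p n s : ℕ} {ξ : Kˣ}

theorem minTuple (H : KummerModule p n (toModule σ ξ)) (hs : 1 ≤ s) {a : ℕ → WithBot ℕ}
    (ha : ∀ i, a i ≤ n) (hlast : a s ≠ ⊥) {e : ℤ} {α : Kˣ} {δ : ℕ → Kˣ}
    (hmin : IsMinimalNormPair p n σ ξ (fun i : Fin (s + 1) => a i) (1 + p * e))
    (hrep : Represents p n σ ξ (fun i : Fin (s + 1) => a i) (1 + p * e) α δ) :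
    MinTuple H s (fun i => (a i).unbotD 0) {i | a i ≠ ⊥} e (toModule σ α)
      (fun j => toModule σ (δ j)) := by
  have ha0 : a 0 < n := hmin.1.2.1 s.succ_pos
  have hla0 : (a 0).unbotD 0 < n := by
    generalize a 0 = b at ha0
    induction b with
    | bot => exact H.pos
    | coe b => exact WithBot.coe_lt_coe.1 ha0
  obtain ⟨hlev, heqn, hchi⟩ := (represents_iff H.prime).1 hrep
  have hlev' (i : ℕ) (hi : i ≤ s) := levelMem_iff.1 (hlev ⟨i, Nat.lt_succ_of_le hi⟩)
  refine ⟨hs, hlast, fun i => ?_, hla0, fun i hi => ?_, fun i hi hI => ?_, heqn, hchi, ?_⟩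
  · have := ha i
    generalize a i = b at this
    induction b with
    | bot => exact Nat.zero_le _
    | coe b => exact WithBot.coe_le_coe.1 this
  · obtain ⟨h1, h2⟩ := hlev' i hi
    dsimp only at h1 h2 ⊢
    generalize a i = b at h1 h2
    induction b with
    | bot => rw [h1 rfl]; exact zero_mem _
    | coe b => exact h2 b rfl
  · exact (hlev' i hi).1 (not_not.1 hI)
  intro i hi hI e' α' δ' κ β hδ' hκ hE
  obtain ⟨l, hl, hl0, hl'⟩ : ∃ l : WithBot ℕ, l < a i ∧ (l = ⊥ → κ = 0) ∧
      ∀ k : ℕ, l = k → κ ∈ lev (UnitModule σ) p k := by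
    rcases hκ with rfl | ⟨k, hk, hκ⟩
    · exact ⟨⊥, bot_lt_iff_ne_bot.2 hI, fun _ => rfl, fun _ _ => zero_mem _⟩
    · refine ⟨k, ?_, fun h => absurd h WithBot.coe_ne_bot, fun k' hk' => ?_⟩
      · generalize a i = b at hk
        induction b with
        | bot => exact absurd hk (Nat.not_lt_zero _)
        | coe b => exact WithBot.coe_lt_coe.2 (by simpa using hk)
      · obtain rfl : k = k' := WithBot.coe_injective hk'
        exact hκ
  obtain ⟨D, hD⟩ : ∃ D : ℕ → UnitModule σ, ∀ j,
      D j = if j < i then δ' j else if j = i then κ else if j = i + 1 then β else 0 :=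
    ⟨_, fun _ => rfl⟩
  have hsum (g : ℕ → ℤ[X]) : ∑ j ∈ range (s + 2), g j • D j =
      ∑ j ∈ range i, g j • δ' j + g i • κ + g (i + 1) • β := by
    rw [← sum_subset (range_subset_range.2 (show i + 2 ≤ s + 2 by omega)), sum_range_succ,
      sum_range_succ, hD i, hD (i + 1)]
    · simp only [lt_irrefl, if_true, if_false, show ¬ i + 1 < i by omega, show i + 1 ≠ i by omega]
      congr 2
      exact sum_congr rfl fun j hj => by rw [hD, if_pos (mem_range.1 hj)]
    · intro j _ hj
      rw [mem_range, not_lt] at hj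
      rw [hD, if_neg (by omega), if_neg (by omega), if_neg (by omega), smul_zero]
  have hln : l < n := hl.trans_le (ha i)
  have hDlev (j : ℕ) : ((if j < i then a j else if j = i then l else n) = (⊥ : WithBot ℕ) →
      D j = 0) ∧ ∀ k : ℕ, (if j < i then a j else if j = i then l else n) = (k : WithBot ℕ) →
        D j ∈ lev (UnitModule σ) p k := by
    rw [hD]
    split_ifs with h1 h2
    · refine ⟨fun h => (hδ' j h1).2 (by simp [h]), fun k hk => ?_⟩
      simpa [hk] using (hδ' j h1).1
    · exact ⟨hl0, hl'⟩
    all_goals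
      refine ⟨fun h => absurd h WithBot.coe_ne_bot, fun k hk => ?_⟩
      obtain rfl : n = k := WithBot.coe_injective hk
      exact H.mem_top _
  have hD0 : D 0 ∈ lev (UnitModule σ) p (n - 1) := by
    have h1 := hDlev 0
    have h2 : (if 0 < i then a 0 else if 0 = i then l else n) < (n : WithBot ℕ) := by
      split_ifs <;> first | assumption | omega
    generalize (if 0 < i then a 0 else if 0 = i then l else (n : WithBot ℕ)) = b at h1 h2
    induction b with
    | bot => rw [h1.1 rfl]; exact zero_mem _
    | coe b => exact lev_mono (Nat.le_sub_one_of_lt (WithBot.coe_lt_coe.1 h2)) (h1.2 b rfl)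
  rw [← hsum fun j => (p : ℤ[X]) ^ j] at hE
  rw [add_assoc, add_assoc, ← add_assoc (∑ j ∈ range i, _), ← hsum (psi p n)]
  obtain ⟨c, hc⟩ := H.tors _ (H.smul_chi_eq_zero hD0 hE)
  rw [hc]
  refine H.intCast_smul_zeta (by_contra fun hpc => ?_)
  obtain ⟨v, u, huv⟩ : IsCoprime (p : ℤ) c :=
    (Nat.prime_iff_prime_int.1 H.prime).irreducible.coprime_iff_not_dvd.2 hpc
  have huv' : (v : ℤ[X]) * (p : ℤ[X]) + u * c = 1 := by exact_mod_cast congrArg (Int.cast) huv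
  obtain ⟨α₁, hα₁⟩ := toModule_surjective σ ((u : ℤ[X]) • α')
  choose δ₁ hδ₁ using fun j => toModule_surjective σ ((u : ℤ[X]) • D j)
  refine not_pairLE_of_lt (p := p) (d := 1 + p * e) (d' := 1 + p * e')
    (a' := fun j : Fin (s + 1) => if (j : ℕ) < i then a j else if (j : ℕ) = i then l else n)
    (a := fun j : Fin (s + 1) => a j) ⟨i, Nat.lt_succ_of_le hi⟩
    (fun j hj => if_pos hj) (by simpa using hl) (hmin.2 _ _
      ⟨fun j => ?_, fun _ => ?_, ⟨e', by ring⟩, α₁, δ₁, (represents_iff H.prime).2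
        ⟨fun j => levelMem_iff.2 ?_, ?_, ?_⟩⟩)
  · dsimp only
    split_ifs
    exacts [ha _, hln.le, le_rfl]
  · dsimp only
    split_ifs <;> first | assumption | omega
  · rw [hδ₁]
    refine ⟨fun h => ?_, fun k hk => Submodule.smul_mem _ _ ((hDlev j).2 k hk)⟩
    rw [(hDlev j).1 h, smul_zero]
  · simp only [hδ₁, hα₁]
    rw [smul_comm, hE, smul_sum]
    exact sum_congr rfl fun j _ => smul_comm _ _ _
  · simp only [hδ₁, hα₁]
    have h1 : ∑ j ∈ range (s + 2), psi p n j • (u : ℤ[X]) • D j =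
        (u : ℤ[X]) • ∑ j ∈ range (s + 2), psi p n j • D j := by
      rw [smul_sum]
      exact sum_congr rfl fun j _ => smul_comm _ _ _
    rw [show s + 1 + 1 = s + 2 from rfl, h1]
    linear_combination (norm := module) (u : ℤ[X]) • hc + huv' • toModule σ ξ -
      (v : ℤ[X]) • H.zeta_tors

end Concrete

end MSS

namespace MSS

section GalSpan

variable {F K : Type*} [Field F] [Field K] [Algebra F K] {σ : K ≃ₐ[F] K}

theorem jcls_eq_one {q : ℕ} {γ : Kˣ} : jcls q γ = 1 ↔ γ ∈ powSub K q :=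
  QuotientGroup.eq_one_iff γ

theorem map_galSpan {q q' : ℕ} (h : q' ∣ q) (S : Set Kˣ) :
    (galSpan q σ S).map (resMap q q' h) = galSpan q' σ S := by
  rw [galSpan, MonoidHom.map_closure, galSpan]
  congr 1
  ext x
  constructor
  · rintro ⟨_, ⟨γ, hγ, k, rfl⟩, rfl⟩
    exact ⟨γ, hγ, k, rfl⟩
  · rintro ⟨γ, hγ, k, rfl⟩
    exact ⟨_, ⟨γ, hγ, k, rfl⟩, rfl⟩

theorem galSpan_union (q : ℕ) (S T : Set Kˣ) :
    galSpan q σ (S ∪ T) = galSpan q σ S ⊔ galSpan q σ T := by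
  rw [galSpan, galSpan, galSpan, ← Subgroup.closure_union]
  congr 1
  ext x
  simp only [Set.mem_union, Set.mem_ofPred_eq, or_and_right, exists_or]

theorem galSpan_one (q : ℕ) : galSpan q σ {1} = ⊥ := by
  rw [galSpan, Subgroup.closure_eq_bot_iff]
  rintro _ ⟨_, rfl, k, rfl⟩
  rw [map_one]
  exact jcls_eq_one.2 (one_mem _)

theorem galSpan_diff_one (q : ℕ) (S : Set Kˣ) : galSpan q σ (S \ {1}) = galSpan q σ S := by
  have h : galSpan q σ (S \ {1} ∪ {1}) = galSpan q σ (S ∪ {1}) := by rw [Set.sdiff_union_self]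
  rwa [galSpan_union, galSpan_union, galSpan_one, sup_bot_eq, sup_bot_eq] at h

theorem galSpan_XmSet {m : ℕ} (hm : 2 ≤ m) (q : ℕ) (α : Kˣ) (δ : ℕ → Kˣ) :
    galSpan q σ (XmSet m α δ) =
      galSpan q σ (XmSet (m - 1) α δ) ⊔ galSpan q σ {δ (m - 1)} := by
  rw [XmSet, XmSet, galSpan_diff_one, galSpan_diff_one, ← galSpan_union, Set.union_assoc,
    ← Set.image_singleton, ← Set.image_union]
  congr 3
  ext j
  simp only [Set.mem_Icc, Set.mem_union, Set.mem_singleton_iff]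
  omega

theorem exists_jcls_eq_of_mem_galSpan {q : ℕ} {S : Set Kˣ}
    {M : Submodule (Polynomial ℤ) (UnitModule σ)} (hS : ∀ γ ∈ S, toModule σ γ ∈ M)
    {x : Kˣ ⧸ powSub K q} (hx : x ∈ galSpan q σ S) : ∃ γ, jcls q γ = x ∧ toModule σ γ ∈ M := by
  induction hx using Subgroup.closure_induction with
  | mem x hx =>
    obtain ⟨γ, hγ, k, rfl⟩ := hx
    refine ⟨_, rfl, ?_⟩
    rw [toModule_umap_pow]
    exact M.smul_mem _ (hS γ hγ)
  | one => exact ⟨1, rfl, by rw [toModule_one]; exact M.zero_mem⟩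
  | mul x y _ _ hx hy =>
    obtain ⟨γ, rfl, hγ⟩ := hx
    obtain ⟨γ', rfl, hγ'⟩ := hy
    exact ⟨γ * γ', rfl, by rw [toModule_mul]; exact M.add_mem hγ hγ'⟩
  | inv x _ hx =>
    obtain ⟨γ, rfl, hγ⟩ := hx
    exact ⟨γ⁻¹, rfl, by rw [toModule_inv]; exact M.neg_mem hγ⟩

theorem jcls_eq_jcls_iff {p r : ℕ} {γ γ' : Kˣ} : jcls (p ^ r) γ = jcls (p ^ r) γ' ↔
    toModule σ γ - toModule σ γ' ∈
      mulRange (UnitModule σ) ((p : Polynomial ℤ) ^ r) := by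
  have h : jcls (p ^ r) (γ * γ'⁻¹) = jcls (p ^ r) γ * (jcls (p ^ r) γ')⁻¹ := rfl
  rw [sub_eq_add_neg, ← toModule_inv, ← toModule_mul, toModule_mem_mulRange, ← jcls_eq_one, h,
    mul_inv_eq_one]

theorem galSpan_inf_eq_bot {p n s : ℕ} {ξ : Kˣ} (H : KummerModule p n (toModule σ ξ)) (hs : 1 ≤ s)
    {a : ℕ → WithBot ℕ} (ha : ∀ i, a i ≤ n) {d : ℤ} {α : Kˣ} {δ : ℕ → Kˣ}
    (hmin : IsMinimalNormPair p n σ ξ (fun i : Fin (s + 1) => a i) d)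
    (hrep : Represents p n σ ξ (fun i : Fin (s + 1) => a i) d α δ) :
    galSpan (p ^ s) σ (XmSet s α δ) ⊓ galSpan (p ^ s) σ {δ s} = ⊥ := by
  by_cases hlast : a s = ⊥
  · have h1 := (levelMem_iff.1 (hrep.1 ⟨s, Nat.lt_succ_self s⟩)).1 hlast
    rw [toModule_eq_zero] at h1
    dsimp only at h1
    rw [h1, galSpan_one, inf_bot_eq]
  obtain ⟨e, he⟩ := hmin.1.2.2.1
  obtain rfl : d = 1 + p * e := by linarith
  have T := minTuple H hs ha hlast hmin hrep
  rw [eq_bot_iff]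
  rintro x ⟨hx, hx'⟩
  obtain ⟨γ, rfl, hγ⟩ := exists_jcls_eq_of_mem_galSpan
    (M := Submodule.span _ {toModule σ α} ⊔
      Submodule.span _ ((fun j => toModule σ (δ j)) '' (Finset.range s : Set ℕ))) (by
    rintro γ ⟨hγ, -⟩
    rcases hγ with hγ | ⟨j, hj, hγ⟩
    · rw [Set.mem_singleton_iff.1 hγ]
      exact Submodule.mem_sup_left (Submodule.mem_span_singleton_self _)
    · rw [← hγ]
      refine Submodule.mem_sup_right (Submodule.subset_span ⟨j, ?_, rfl⟩)
      have := hj.2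
      rw [Finset.coe_range, Set.mem_Iio]
      omega) hx
  obtain ⟨γ', hγγ', hγ'⟩ := exists_jcls_eq_of_mem_galSpan
    (M := Submodule.span _ {toModule σ (δ s)}) (by
    intro γ hγ
    rw [Set.mem_singleton_iff.1 hγ]
    exact Submodule.mem_span_singleton_self _) hx'
  obtain ⟨y, hy, z, hz, hyz⟩ := Submodule.mem_sup.1 hγ
  obtain ⟨f, hf⟩ := Submodule.mem_span_singleton.1 hy
  obtain ⟨g, hg⟩ := Submodule.mem_span_image_finset_iff_exists_fun' _ |>.1 hz
  obtain ⟨h, hh⟩ := Submodule.mem_span_singleton.1 hγ'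
  have hdiv := jcls_eq_jcls_iff (σ := σ).1 hγγ'.symm
  rw [← hyz, ← hf, ← hg, ← hh] at hdiv
  have := T.smul_last_mem (f := f) (g := g) (h := h) hdiv
  rw [hh, toModule_mem_mulRange, ← jcls_eq_one, hγγ'] at this
  exact this

end GalSpan

end MSS

/-- **Lemma.**  For `m ≥ 2`, the image `[X]_{m-1}` of the `m`-exceptional module
`X = ⟨[α]_m, [δ_1]_m, …, [δ_{m-1}]_m⟩` under `J_m → J_{m-1}` is the internal
direct sum of the `R_{m-1}[G]`-submodule generated by
`[α]_{m-1}, [δ_1]_{m-1}, …, [δ_{m-2}]_{m-1}` and the cyclic submodule generated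
by `[δ_{m-1}]_{m-1}`. -/
theorem statement_19 {F : Type u} {K : Type v} [Field F] [Field K] [Algebra F K]
    [IsGalois F K] [FiniteDimensional F K]
    (p n m : ℕ) (hp : p.Prime) (hn : 0 < n) (hm : 2 ≤ m)
    (σ : K ≃ₐ[F] K) (horder : orderOf σ = p ^ n)
    (hgen : ∀ τ : K ≃ₐ[F] K, τ ∈ Subgroup.zpowers σ)
    (ξ : Kˣ) (hξ : IsPrimitiveRoot (ξ : K) p)
    (hξF : (ξ : K) ∈ Set.range (algebraMap F K))
    (hspecial : p = 2 → n = 1 → ∃ γ : Kˣ, MSS.normHom p σ n γ = -1)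
    (a : Fin m → WithBot ℕ) (d : ℤ) (α : Kˣ) (δ : ℕ → Kˣ)
    (hmin : MSS.IsMinimalNormPair p n σ ξ a d)
    (hrep : MSS.Represents p n σ ξ a d α δ) :
    Subgroup.map (MSS.resMap (p ^ m) (p ^ (m - 1)) (pow_dvd_pow p (by omega)))
        (MSS.galSpan (p ^ m) σ (MSS.XmSet m α δ)) =
      MSS.galSpan (p ^ (m - 1)) σ (MSS.XmSet (m - 1) α δ) ⊔
        MSS.galSpan (p ^ (m - 1)) σ {δ (m - 1)} ∧
    MSS.galSpan (p ^ (m - 1)) σ (MSS.XmSet (m - 1) α δ) ⊓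
        MSS.galSpan (p ^ (m - 1)) σ {δ (m - 1)} = ⊥ := by
  refine ⟨?_, ?_⟩
  · rw [MSS.map_galSpan]
    exact MSS.galSpan_XmSet hm _ α δ
  obtain ⟨s, rfl⟩ : ∃ s, m = s + 1 := ⟨m - 1, by omega⟩
  have ha : a = fun i : Fin (s + 1) => a (Fin.ofNat (s + 1) (i : ℕ)) := by
    funext i
    rw [Fin.ofNat_val_eq_self]
  have hle : ∀ i : ℕ, a (Fin.ofNat (s + 1) i) ≤ n := fun i => hmin.1.1 _
  rw [ha] at hmin hrep
  exact MSS.galSpan_inf_eq_bot (a := fun i => a (Fin.ofNat (s + 1) i))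
    (MSS.kummerModule σ hp hn horder hξ hξF) (by omega) hle hmin hrep
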